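/- arXiv:math/0604413 — 2 statements merged into one kernel-verified Lean document; each statement's English description precedes it below -/
import Mathlib

section
/- Let q = 3^d with d odd, let K be a finite field with q elements, and let a ∈ K with Tr_{K/F_3}(a) ≠ 0. Then the number of pairs (z, y) ∈ K × K with y^2 = z^6 + a^2 z^3 + a^2 z + a^4 + 1 equals q − 1, and the number of pairs (z, y) ∈ L × L with y^2 = z^6 + a^2 z^3 + a^2 z + a^4 + 1, where L is a field with q^2 elements containing K, equals q^2 + 2q − 1. (These counts express that the genus-2 curve y^2 = z^6 + a^2 z^3 + a^2 z + a^4 + 1 over F_q has Weil polynomial x^4 + q x^2 + q^2.) -/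
section CharSums

variable {F : Type*} [Field F] [CharP F 3] {ψ : AddChar F ℂ}

lemma three_eq_zero_of_charP (R : Type*) [Ring R] [CharP R 3] : (3 : R) = 0 := by
  exact_mod_cast CharP.cast_eq_zero R 3

lemma cube_injective_of_charP (R : Type*) [Field R] [CharP R 3] :
    Function.Injective fun x : R => x ^ 3 :=
  frobenius_inj R 3

lemma AddChar.pow_three_eq_one (x : F) : ψ x ^ 3 = 1 := by
  have h : (3 : ℕ) • x = 0 := by
    rw [nsmul_eq_mul]; push_cast; rw [three_eq_zero_of_charP F, zero_mul]
  rw [← AddChar.map_nsmul_eq_pow, h, AddChar.map_zero_eq_one]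

lemma AddChar.apply_ne_zero (x : F) : ψ x ≠ 0 := by
  intro h
  simpa [h] using AddChar.pow_three_eq_one (ψ := ψ) x

lemma AddChar.eq_of_sub_eq_cube_sub (hF : ∀ x, ψ (x ^ 3) = ψ x) {x y : F} (p : F)
    (h : x - y = p ^ 3 - p) : ψ x = ψ y := by
  have hx : x + p = y + p ^ 3 := by linear_combination h
  have h2 := congrArg ψ hx
  rw [AddChar.map_add_eq_mul, AddChar.map_add_eq_mul, hF] at h2
  exact mul_right_cancel₀ (AddChar.apply_ne_zero p) h2

lemma AddChar.map_neg_eq_sq (x : F) : ψ (-x) = ψ x ^ 2 := by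
  have h : ψ (-x) * ψ x = 1 := by
    rw [← AddChar.map_add_eq_mul, neg_add_cancel, AddChar.map_zero_eq_one]
  apply mul_right_cancel₀ (AddChar.apply_ne_zero (ψ := ψ) x)
  linear_combination h - AddChar.pow_three_eq_one (ψ := ψ) x

/-- A cube root of unity different from `1` satisfies `1 + ω + ω² = 0`. -/
lemma AddChar.one_add_add_eq_zero {x : F} (hx : ψ x ≠ 1) : 1 + ψ x + ψ (-x) = 0 := by
  rw [AddChar.map_neg_eq_sq]
  have h1 := AddChar.pow_three_eq_one (ψ := ψ) x
  have : (ψ x - 1) * (1 + ψ x + ψ x ^ 2) = 0 := by linear_combination h1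
  exact (mul_eq_zero.1 this).resolve_left (sub_ne_zero.2 hx)

variable [Fintype F]

open Classical in
lemma sum_comp_eq_sum_card_mul {α β : Type*} [Fintype α] [Fintype β] (φ : α → β) (f : β → ℂ) :
    ∑ w, f (φ w) = ∑ y, ((Finset.univ.filter fun w => φ w = y).card : ℂ) * f y := by
  rw [← Finset.sum_fiberwise Finset.univ φ]
  refine Finset.sum_congr rfl fun y _ => ?_
  rw [Finset.sum_congr rfl (g := fun _ => f y), Finset.sum_const, nsmul_eq_mul]
  intro w hw
  rw [(Finset.mem_filter.1 hw).2]

open Classical in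
/-- Fourier count of the solutions of an affine equation whose linear part is
an additive cubic polynomial. -/
lemma card_additive_cubic_eq (hψ : ψ.IsPrimitive) (hF : ∀ x, ψ (x ^ 3) = ψ x) (α β y : F) :
    ((Finset.univ.filter fun w => α * w ^ 3 - β * w = y).card : ℂ)
      = ∑ m with α * m = β ^ 3 * m ^ 3, ψ (-(m * y)) := by
  have hq : (Fintype.card F : ℂ) ≠ 0 := by exact_mod_cast Fintype.card_ne_zero
  have h1 : (Fintype.card F : ℂ) *
      ((Finset.univ.filter fun w => α * w ^ 3 - β * w = y).card : ℂ)
      = ∑ w, ∑ m, ψ (m * (α * w ^ 3 - β * w - y)) := by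
    rw [Finset.card_filter]
    push_cast
    rw [Finset.mul_sum]
    refine Finset.sum_congr rfl fun w _ => ?_
    rw [AddChar.sum_mulShift _ hψ]
    by_cases h : α * w ^ 3 - β * w = y
    · simp [h]
    · simp [h, sub_eq_zero]
  have hbij : Function.Bijective fun x : F => x ^ 3 :=
    Finite.injective_iff_bijective.1 (cube_injective_of_charP F)
  have h2 : ∀ m, ∑ w, ψ (m * (α * w ^ 3 - β * w - y))
      = ψ (-(m * y)) * (if α * m = β ^ 3 * m ^ 3 then (Fintype.card F : ℂ) else 0) := by
    intro m
    have h3 : ∀ w, ψ (m * (α * w ^ 3 - β * w - y))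
        = ψ (-(m * y)) * ψ (w ^ 3 * (α * m - β ^ 3 * m ^ 3)) := by
      intro w
      rw [← AddChar.map_add_eq_mul]
      exact AddChar.eq_of_sub_eq_cube_sub hF (β * m * w) (by ring)
    rw [Finset.sum_congr rfl fun w _ => h3 w, ← Finset.mul_sum,
      hbij.sum_comp fun x => ψ (x * (α * m - β ^ 3 * m ^ 3)), AddChar.sum_mulShift _ hψ]
    simp [sub_eq_zero]
  rw [Finset.sum_comm, Finset.sum_congr rfl fun m _ => h2 m] at h1
  apply mul_left_cancel₀ hq
  rw [h1, Finset.sum_filter, Finset.mul_sum]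
  refine Finset.sum_congr rfl fun m _ => ?_
  split_ifs <;> ring

lemma sum_comp_cube_sub (hψ : ψ.IsPrimitive) (hF : ∀ x, ψ (x ^ 3) = ψ x) {β δ : F}
    (hδ : β ^ 3 * δ ^ 2 = 1) (f : F → ℂ) :
    ∑ w, f (w ^ 3 - β * w) = ∑ y, (1 + ψ (δ * y) + ψ (-(δ * y))) * f y := by
  classical
  rw [sum_comp_eq_sum_card_mul (fun w => w ^ 3 - β * w)]
  refine Finset.sum_congr rfl fun y _ => ?_
  congr 1
  have h := card_additive_cubic_eq hψ hF 1 β y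
  simp only [one_mul] at h
  rw [h]
  have hδ0 : δ ≠ 0 := by rintro rfl; simp at hδ
  have hβ0 : β ≠ 0 := by rintro rfl; simp at hδ
  have hneg : -δ ≠ δ := by
    intro h
    apply hδ0
    linear_combination δ * three_eq_zero_of_charP F + h
  have hs : (Finset.univ.filter fun m : F => m = β ^ 3 * m ^ 3) = {0, δ, -δ} := by
    ext m
    simp only [Finset.mem_filter, Finset.mem_univ, true_and, Finset.mem_insert,
      Finset.mem_singleton]
    constructor
    · intro hm
      have : β ^ 3 * (m * ((m - δ) * (m + δ))) = 0 := by
        linear_combination -hm - m * hδ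
      rcases mul_eq_zero.1 ((mul_eq_zero.1 this).resolve_left (pow_ne_zero _ hβ0)) with h | h
      · exact Or.inl h
      · rcases mul_eq_zero.1 h with h | h
        · exact Or.inr (Or.inl (sub_eq_zero.1 h))
        · exact Or.inr (Or.inr (eq_neg_of_add_eq_zero_left h))
    · rintro (rfl | rfl | rfl)
      · simp
      · linear_combination -m * hδ
      · linear_combination δ * hδ
  rw [hs, Finset.sum_insert, Finset.sum_insert, Finset.sum_singleton]
  · simp; ring
  · simpa using hneg.symm
  · simp [hδ0, hδ0.symm]

open Classical in
lemma card_cube_add_sq_eq (hψ : ψ.IsPrimitive) (hF : ∀ x, ψ (x ^ 3) = ψ x) {κ : F} (hκ : κ ≠ 0)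
    (y : F) :
    ((Finset.univ.filter fun s => κ * s ^ 3 + s ^ 2 = y).card : ℂ)
      = 1 + ∑ m with m ^ 2 = y, ψ (-(m * κ)) := by
  by_cases hy : y = 0
  · subst hy
    have h1 : (Finset.univ.filter fun s : F => κ * s ^ 3 + s ^ 2 = 0) = {0, -κ⁻¹} := by
      ext s
      simp only [Finset.mem_filter, Finset.mem_univ, true_and, Finset.mem_insert,
        Finset.mem_singleton]
      constructor
      · intro h
        have : s ^ 2 * (κ * s + 1) = 0 := by linear_combination h
        rcases mul_eq_zero.1 this with h | h
        · exact Or.inl (pow_eq_zero_iff two_ne_zero |>.1 h)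
        · right
          field_simp
          linear_combination h
      · rintro (rfl | rfl)
        · simp
        · field_simp
          ring
    have h2 : (Finset.univ.filter fun m : F => m ^ 2 = 0) = {0} := by
      ext m; simp
    rw [h1, h2, Finset.card_pair (by simp [hκ, eq_comm])]
    norm_num
  · have h1 : (Finset.univ.filter fun s : F => κ * s ^ 3 + s ^ 2 = y).card
        = (Finset.univ.filter fun t : F => y * t ^ 3 - 1 * t = κ).card := by
      have key : ∀ s : F, s ≠ 0 → (κ * s ^ 3 + s ^ 2 = y ↔ y * s⁻¹ ^ 3 - 1 * s⁻¹ = κ) := by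
        intro s hs
        field_simp
        constructor <;> intro h
        · linear_combination -h
        · linear_combination -h
      refine Finset.card_bij' (fun s _ => s⁻¹) (fun t _ => t⁻¹) ?_ ?_ ?_ ?_
      · intro s hs
        simp only [Finset.mem_filter, Finset.mem_univ, true_and] at hs ⊢
        refine (key s ?_).1 hs
        rintro rfl
        exact hy (by simpa using hs.symm)
      · intro t ht
        simp only [Finset.mem_filter, Finset.mem_univ, true_and] at ht ⊢
        refine (key t⁻¹ ?_).2 (by simpa using ht)
        rw [ne_eq, inv_eq_zero]
        rintro rfl
        exact hκ (by simpa using ht.symm)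
      · simp
      · simp
    have h2 : (Finset.univ.filter fun m : F => y * m = 1 ^ 3 * m ^ 3)
        = insert 0 (Finset.univ.filter fun m : F => m ^ 2 = y) := by
      ext m
      simp only [Finset.mem_filter, Finset.mem_univ, true_and, Finset.mem_insert]
      constructor
      · intro h
        have : m * (m ^ 2 - y) = 0 := by linear_combination -h
        rcases mul_eq_zero.1 this with h | h
        · exact Or.inl h
        · exact Or.inr (sub_eq_zero.1 h)
      · rintro (rfl | rfl)
        · simp
        · ring
    rw [h1, card_additive_cubic_eq hψ hF, h2, Finset.sum_insert]
    · simp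
    · simpa using fun h => hy h.symm

lemma sum_comp_cube_add_sq (hψ : ψ.IsPrimitive) (hF : ∀ x, ψ (x ^ 3) = ψ x) {κ : F}
    (hκ : κ ≠ 0) (f : F → ℂ) :
    ∑ s, f (κ * s ^ 3 + s ^ 2) = ∑ y, f y + ∑ m, f (m ^ 2) * ψ (-(m * κ)) := by
  classical
  rw [sum_comp_eq_sum_card_mul (fun s => κ * s ^ 3 + s ^ 2),
    ← Finset.sum_fiberwise Finset.univ (fun m : F => m ^ 2) (fun m => f (m ^ 2) * ψ (-(m * κ))),
    ← Finset.sum_add_distrib]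
  refine Finset.sum_congr rfl fun y _ => ?_
  rw [card_cube_add_sq_eq hψ hF hκ, add_mul, one_mul, Finset.sum_mul]
  congr 1
  refine Finset.sum_congr rfl fun m hm => ?_
  rw [(Finset.mem_filter.1 hm).2, mul_comm]

lemma sum_quadratic_eq {α : F} (hα : α ≠ 0) (β : F) :
    ∑ y, ψ (α * y ^ 2 + β * y) = ψ (-(β ^ 2 / α)) * ∑ y, ψ (α * y ^ 2) := by
  rw [← Equiv.sum_comp (Equiv.subRight (β / α)) fun y => ψ (α * y ^ 2), Finset.mul_sum]
  refine Finset.sum_congr rfl fun y _ => ?_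
  rw [← AddChar.map_add_eq_mul, Equiv.subRight_apply]
  congr 1
  field_simp
  linear_combination (α * y * β) * three_eq_zero_of_charP F

lemma sum_sq_add_sum_neg_sq (h : ¬ IsSquare (-1 : F)) (f : F → ℂ) :
    ∑ y, f (y ^ 2) + ∑ y, f (-y ^ 2) = 2 * ∑ n, f n := by
  classical
  have h2 : ringChar F ≠ 2 := by rw [ringChar.eq F 3]; norm_num
  have hc : ∀ n : F, ((Finset.univ.filter fun w : F => w ^ 2 = n).card : ℂ)
      = (quadraticChar F n : ℂ) + 1 := by
    intro n
    have := quadraticChar_card_sqrts h2 n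
    rw [Set.toFinset_ofPred] at this
    exact_mod_cast this
  have hneg : ∀ n : F, quadraticChar F (-n) = - quadraticChar F n := by
    intro n
    rw [← neg_one_mul, map_mul, quadraticChar_neg_one_iff_not_isSquare.2 h]
    ring
  rw [sum_comp_eq_sum_card_mul (fun y : F => y ^ 2),
    sum_comp_eq_sum_card_mul (fun y : F => y ^ 2) (fun y => f (-y)),
    ← Equiv.sum_comp (Equiv.neg F) fun y => _ * f (-y), ← Finset.sum_add_distrib, Finset.mul_sum]
  refine Finset.sum_congr rfl fun y _ => ?_
  simp only [Equiv.neg_apply, hc, hneg, neg_neg]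
  push_cast
  ring

/-- The affine points of the genus-2 curve, counted by a quintic exponential sum. -/
lemma card_curve_eq (hψ : ψ.IsPrimitive) (hF : ∀ x, ψ (x ^ 3) = ψ x) {a b e : F}
    (hab : a = b ^ 3) (heb : e * b = 1) :
    (Nat.card {P : F × F //
        P.2 ^ 2 = P.1 ^ 6 + a ^ 2 * P.1 ^ 3 + a ^ 2 * P.1 + a ^ 4 + 1} : ℂ)
      = Fintype.card F - 1 + ∑ v, ψ (-e ^ 9 * v ^ 5 + (e + e ^ 9) * v) := by
  classical
  have h3 := three_eq_zero_of_charP F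
  have hb : b ≠ 0 := right_ne_zero_of_mul_eq_one heb
  have ha : a ≠ 0 := hab ▸ pow_ne_zero 3 hb
  have e1 : {P : F × F // P.2 ^ 2 = P.1 ^ 6 + a ^ 2 * P.1 ^ 3 + a ^ 2 * P.1 + a ^ 4 + 1}
      ≃ (u : F) × {z : F // u * z ^ 3 - (-a ^ 2) * z = u ^ 2 + a ^ 2 * u - 1} :=
    { toFun := fun P => ⟨P.1.2 - (P.1.1 ^ 3 - a ^ 2), P.1.1, by
        grind⟩
      invFun := fun Q => ⟨(Q.2.1, Q.1 + (Q.2.1 ^ 3 - a ^ 2)), by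
        grind⟩
      left_inv := by rintro ⟨⟨z, y⟩, h⟩; simp
      right_inv := by
        rintro ⟨u, z, h⟩
        refine Sigma.subtype_ext ?_ rfl
        simp }
  have h1 : (Nat.card {P : F × F //
        P.2 ^ 2 = P.1 ^ 6 + a ^ 2 * P.1 ^ 3 + a ^ 2 * P.1 + a ^ 4 + 1} : ℂ)
      = ∑ u, ∑ m with u * m = (-a ^ 2) ^ 3 * m ^ 3, ψ (-(m * (u ^ 2 + a ^ 2 * u - 1))) := by
    rw [Nat.card_congr e1, Nat.card_eq_fintype_card, Fintype.card_sigma]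
    push_cast
    refine Finset.sum_congr rfl fun u _ => ?_
    rw [Fintype.card_subtype, card_additive_cubic_eq hψ hF]
  have h2 : ∀ m, ∑ u, (if u * m = (-a ^ 2) ^ 3 * m ^ 3
        then ψ (-(m * (u ^ 2 + a ^ 2 * u - 1))) else 0)
      = (if m = 0 then (Fintype.card F - 1 : ℂ) else 0)
        + ψ (-e ^ 9 * (b ^ 9 * m) ^ 5 + (e + e ^ 9) * (b ^ 9 * m)) := by
    intro m
    by_cases hm : m = 0
    · subst hm
      simp
    · rw [if_neg hm, zero_add, Finset.sum_eq_single ((-a ^ 2) ^ 3 * m ^ 2)]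
      · rw [if_pos (by ring)]
        refine AddChar.eq_of_sub_eq_cube_sub hF (b ^ 8 * m) ?_
        subst hab
        have h9 : e ^ 9 * b ^ 9 = 1 := by rw [← mul_pow, heb, one_pow]
        linear_combination (b ^ 36 * m ^ 5 - m) * h9 - b ^ 8 * m * heb
      · intro u _ hu
        rw [if_neg]
        intro h
        apply hu
        apply mul_right_cancel₀ hm
        linear_combination h
      · simp
  simp only [Finset.sum_filter] at h1
  rw [h1, Finset.sum_comm, Finset.sum_congr rfl fun m _ => h2 m, Finset.sum_add_distrib]
  congr 1
  · simp
  · exact Equiv.sum_comp (Equiv.mulLeft₀ (b ^ 9) (pow_ne_zero 9 hb))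
      fun v => ψ (-e ^ 9 * v ^ 5 + (e + e ^ 9) * v)

/-- Evaluation of the quintic exponential sum over a field containing a primitive eighth root
of unity `ζ`. -/
lemma sum_quintic_eq_of_pow_four_eq_neg_one (hψ : ψ.IsPrimitive) (hF : ∀ x, ψ (x ^ 3) = ψ x)
    {ζ b e : F} (hζ : ζ ^ 4 = -1) (heb : e * b = 1) {g : ℂ}
    (hg : ∑ y, ψ (ζ * e ^ 9 * y ^ 2) = g) (hg' : ∑ y, ψ (ζ ^ 3 * e ^ 9 * y ^ 2) = g)
    (hω : ψ (ζ * b ^ 3) ≠ 1) (hω' : ψ (ζ * b ^ 9) = ψ (ζ * b ^ 3)) :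
    ∑ v, ψ (-e ^ 9 * v ^ 5 + (e + e ^ 9) * v) = -2 * g := by
  have h3 := three_eq_zero_of_charP F
  have hζ0 : ζ ≠ 0 := by rintro rfl; norm_num at hζ
  have he0 : e ≠ 0 := left_ne_zero_of_mul_eq_one heb
  have hbe : b = e⁻¹ := eq_inv_of_mul_eq_one_right heb
  have h6 : e ^ 9 * b ^ 6 = e ^ 3 := by rw [hbe]; field_simp
  have h12 : e ^ 9 * b ^ 12 = b ^ 3 := by rw [hbe]; field_simp
  set ω := ψ (ζ * b ^ 3) with hωdef
  have hω3 : ω ^ 3 = 1 := AddChar.pow_three_eq_one _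
  have hω0 : 1 + ω + ω ^ 2 = 0 := by
    rw [hωdef, ← AddChar.map_neg_eq_sq]; exact AddChar.one_add_add_eq_zero hω
  have hstep1 : ∀ s, ψ (-e ^ 9 * (s + ζ) ^ 5 + (e + e ^ 9) * (s + ζ))
      = ω ^ 2 * ψ (ζ * e ^ 9 * (-ζ ^ 3 * s ^ 3 + s ^ 2 + (ζ ^ 2 - b ^ 6)) ^ 2) := by
    intro s
    rw [hωdef, ← AddChar.map_neg_eq_sq, ← AddChar.map_add_eq_mul]
    symm
    refine AddChar.eq_of_sub_eq_cube_sub hF (-ζ * e ^ 3 * s ^ 2 + e * s + ζ * e) ?_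
    grind
  have hstep3 : ∀ m, ψ (ζ * e ^ 9 * (m ^ 2 + (ζ ^ 2 - b ^ 6)) ^ 2) * ψ (-(m * -ζ ^ 3))
      = ω * ψ (ζ ^ 3 * e ^ 9 * (m ^ 3 - -ζ ^ 2 * m) ^ 2 + -ζ * (m ^ 3 - -ζ ^ 2 * m)) := by
    intro m
    rw [hωdef, ← AddChar.map_add_eq_mul, ← AddChar.map_add_eq_mul]
    refine AddChar.eq_of_sub_eq_cube_sub hF (-ζ * e ^ 3 * m ^ 2 + ζ ^ 3 * m - ζ ^ 3 * e ^ 3) ?_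
    grind
  have hα : ζ ^ 3 * e ^ 9 ≠ 0 := mul_ne_zero (pow_ne_zero _ hζ0) (pow_ne_zero _ he0)
  have hgauss : ∀ j : F, ∑ y, ψ (j * ζ ^ 3 * y) * ψ (ζ ^ 3 * e ^ 9 * y ^ 2 + -ζ * y)
      = ψ ((-j ^ 2 + 1) * (ζ ^ 3 * b ^ 9) + 2 * j * (ζ * b ^ 9)) * g := by
    intro j
    rw [← hg']
    have h := sum_quadratic_eq (ψ := ψ) hα (j * ζ ^ 3 - ζ)
    rw [show -((j * ζ ^ 3 - ζ) ^ 2 / (ζ ^ 3 * e ^ 9))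
        = (-j ^ 2 + 1) * (ζ ^ 3 * b ^ 9) + 2 * j * (ζ * b ^ 9) by
      rw [hbe]; field_simp; grind] at h
    rw [← h]
    refine Finset.sum_congr rfl fun y _ => ?_
    rw [← AddChar.map_add_eq_mul]
    congr 1
    ring
  have hζ3 : ψ (ζ ^ 3 * b ^ 9) = ω := by
    rw [hωdef, ← hF (ζ * b ^ 3)]; congr 1; ring
  have hj0 := hgauss 0
  have hj1 := hgauss 1
  have hj2 := hgauss (-1)
  rw [show (-0 ^ 2 + 1) * (ζ ^ 3 * b ^ 9) + 2 * 0 * (ζ * b ^ 9) = ζ ^ 3 * b ^ 9 by ring,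
    hζ3] at hj0
  rw [show (-1 ^ 2 + 1) * (ζ ^ 3 * b ^ 9) + 2 * 1 * (ζ * b ^ 9) = -(ζ * b ^ 9) by
    linear_combination ζ * b ^ 9 * h3, AddChar.map_neg_eq_sq, hω'] at hj1
  rw [show (-(-1) ^ 2 + 1) * (ζ ^ 3 * b ^ 9) + 2 * (-1) * (ζ * b ^ 9) = ζ * b ^ 9 by
    linear_combination -ζ * b ^ 9 * h3, hω'] at hj2
  have hstep4 : ∑ m, ψ (ζ ^ 3 * e ^ 9 * (m ^ 3 - -ζ ^ 2 * m) ^ 2 + -ζ * (m ^ 3 - -ζ ^ 2 * m))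
      = (2 * ω + ω ^ 2) * g := by
    rw [sum_comp_cube_sub hψ hF (β := -ζ ^ 2) (δ := ζ ^ 3) (by grind)
      fun y => ψ (ζ ^ 3 * e ^ 9 * y ^ 2 + -ζ * y)]
    have : ∀ y, (1 + ψ (ζ ^ 3 * y) + ψ (-(ζ ^ 3 * y))) * ψ (ζ ^ 3 * e ^ 9 * y ^ 2 + -ζ * y)
        = ψ (0 * ζ ^ 3 * y) * ψ (ζ ^ 3 * e ^ 9 * y ^ 2 + -ζ * y)
          + ψ (1 * ζ ^ 3 * y) * ψ (ζ ^ 3 * e ^ 9 * y ^ 2 + -ζ * y)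
          + ψ (-1 * ζ ^ 3 * y) * ψ (ζ ^ 3 * e ^ 9 * y ^ 2 + -ζ * y) := by
      intro y
      simp only [zero_mul, AddChar.map_zero_eq_one, one_mul, neg_mul]
      ring
    rw [Finset.sum_congr rfl fun y _ => this y, Finset.sum_add_distrib, Finset.sum_add_distrib,
      hj0, hj1, hj2]
    ring
  have hshift : ∑ y, ψ (ζ * e ^ 9 * (y + (ζ ^ 2 - b ^ 6)) ^ 2) = g := by
    rw [← hg]
    exact Equiv.sum_comp (Equiv.addRight (ζ ^ 2 - b ^ 6)) fun y => ψ (ζ * e ^ 9 * y ^ 2)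
  rw [← Equiv.sum_comp (Equiv.addRight ζ)]
  simp only [Equiv.coe_addRight]
  rw [Finset.sum_congr rfl fun s _ => hstep1 s, ← Finset.mul_sum,
    sum_comp_cube_add_sq hψ hF (neg_ne_zero.2 (pow_ne_zero 3 hζ0))
      fun y => ψ (ζ * e ^ 9 * (y + (ζ ^ 2 - b ^ 6)) ^ 2),
    Finset.sum_congr rfl fun m _ => hstep3 m, ← Finset.mul_sum, hstep4,
    hshift]
  linear_combination (2 * ω + ω ^ 2) * g * hω3 + 2 * g * hω0

lemma sum_neg_quadratic_eq_neg (hψ : ψ.IsPrimitive) (h : ¬ IsSquare (-1 : F)) {κ : F}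
    (hκ : κ ≠ 0) : ∑ y, ψ (-(κ * y ^ 2)) = -∑ y, ψ (κ * y ^ 2) := by
  classical
  have h1 := sum_sq_add_sum_neg_sq h fun n => ψ (n * κ)
  rw [AddChar.sum_mulShift _ hψ, if_neg hκ, Nat.cast_zero, mul_zero] at h1
  rw [eq_neg_iff_add_eq_zero, ← h1, add_comm]
  congr 1 <;> refine Finset.sum_congr rfl fun y _ => congrArg ψ (by ring)

lemma sum_quadratic_sq_eq_neg_card (hψ : ψ.IsPrimitive) (h : ¬ IsSquare (-1 : F)) {κ : F}
    (hκ : κ ≠ 0) : (∑ y, ψ (κ * y ^ 2)) ^ 2 = -(Fintype.card F : ℂ) := by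
  classical
  have h3 := three_eq_zero_of_charP F
  have h1 : (∑ y, ψ (κ * y ^ 2)) * ∑ y, ψ (-(κ * y ^ 2)) = Fintype.card F := by
    rw [mul_comm, Finset.sum_mul]
    have h2 : ∀ y, ψ (-(κ * y ^ 2)) * ∑ x, ψ (κ * x ^ 2)
        = ∑ t, ψ (κ * t ^ 2) * ψ (y * (-κ * t)) := by
      intro y
      rw [Finset.mul_sum, ← Equiv.sum_comp (Equiv.addRight y)]
      refine Finset.sum_congr rfl fun t _ => ?_
      rw [← AddChar.map_add_eq_mul, ← AddChar.map_add_eq_mul, Equiv.coe_addRight]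
      congr 1
      linear_combination κ * t * y * h3
    rw [Finset.sum_congr rfl fun y _ => h2 y, Finset.sum_comm]
    simp only [← Finset.mul_sum]
    rw [Finset.sum_eq_single 0]
    · simp
    · intro t _ ht
      rw [AddChar.sum_mulShift _ hψ, if_neg (mul_ne_zero (neg_ne_zero.2 hκ) ht)]
      simp
    · simp
  rw [sum_neg_quadratic_eq_neg hψ h hκ] at h1
  linear_combination -h1

lemma sum_even_decic_eq (hψ : ψ.IsPrimitive) (hF : ∀ x, ψ (x ^ 3) = ψ x)
    (h : ¬ IsSquare (-1 : F)) {b e ε : F} (heb : e * b = 1) (hε : ε ^ 2 = 1) :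
    ∑ u, ψ (ε * (e ^ 9 * u ^ 10 + (e + e ^ 9) * u ^ 2))
      = (1 + 2 * ψ (-(ε * b ^ 9))) * ∑ y, ψ (ε * e ^ 9 * y ^ 2) := by
  have h3 := three_eq_zero_of_charP F
  have he0 : e ≠ 0 := left_ne_zero_of_mul_eq_one heb
  have hε0 : ε ≠ 0 := by rintro rfl; simp at hε
  have hα : ε * e ^ 9 ≠ 0 := mul_ne_zero hε0 (pow_ne_zero _ he0)
  have hbe : b = e⁻¹ := eq_inv_of_mul_eq_one_right heb
  have h1 : ∀ u, ψ (ε * (e ^ 9 * u ^ 10 + (e + e ^ 9) * u ^ 2))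
      = ψ (ε * e ^ 9 * ((u ^ 3 - 1 * u) ^ 3 + (u ^ 3 - 1 * u)) ^ 2) := by
    intro u
    symm
    refine AddChar.eq_of_sub_eq_cube_sub hF (ε * (e ^ 3 * u ^ 6 + e * u ^ 2)) ?_
    grind
  have hbij : Function.Bijective fun t : F => t ^ 3 + t := by
    refine Finite.injective_iff_bijective.1 fun s t hst => ?_
    have hst : s ^ 3 + s = t ^ 3 + t := hst
    have h4 : (s - t) * ((s - t) ^ 2 + 1) = 0 := by
      linear_combination hst - s * t * (s - t) * h3
    rcases mul_eq_zero.1 h4 with h4 | h4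
    · exact sub_eq_zero.1 h4
    · exact absurd ⟨s - t, by linear_combination -h4⟩ h
  have h5 : ∀ t, (1 + ψ (1 * t) + ψ (-(1 * t))) * ψ (ε * e ^ 9 * (t ^ 3 + t) ^ 2)
      = (1 + ψ (-(t ^ 3 + t)) + ψ (t ^ 3 + t)) * ψ (ε * e ^ 9 * (t ^ 3 + t) ^ 2) := by
    intro t
    rw [AddChar.eq_of_sub_eq_cube_sub hF (x := 1 * t) (y := -(t ^ 3 + t)) t
        (by linear_combination t * h3),
      AddChar.eq_of_sub_eq_cube_sub hF (x := -(1 * t)) (y := t ^ 3 + t) (-t)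
        (by linear_combination -t * h3)]
  rw [Finset.sum_congr rfl fun u _ => h1 u,
    sum_comp_cube_sub hψ hF (β := 1) (δ := 1) (by ring)
      fun t => ψ (ε * e ^ 9 * (t ^ 3 + t) ^ 2),
    Finset.sum_congr rfl fun t _ => h5 t,
    hbij.sum_comp fun y => (1 + ψ (-y) + ψ y) * ψ (ε * e ^ 9 * y ^ 2)]
  have h6 : ∀ y, (1 + ψ (-y) + ψ y) * ψ (ε * e ^ 9 * y ^ 2) = ψ (ε * e ^ 9 * y ^ 2)
      + ψ (ε * e ^ 9 * y ^ 2 + -1 * y) + ψ (ε * e ^ 9 * y ^ 2 + 1 * y) := by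
    intro y
    rw [AddChar.map_add_eq_mul, AddChar.map_add_eq_mul]
    simp only [neg_mul, one_mul]
    ring
  have h7 : -(1 / (ε * e ^ 9)) = -(ε * b ^ 9) := by
    rw [hbe]
    field_simp
    rw [hε]
  rw [Finset.sum_congr rfl fun y _ => h6 y, Finset.sum_add_distrib, Finset.sum_add_distrib,
    sum_quadratic_eq hα, sum_quadratic_eq hα, neg_one_sq, one_pow, h7]
  ring

lemma sum_sum_symmetric_quintic_eq_card (hψ : ψ.IsPrimitive) (hF : ∀ x, ψ (x ^ 3) = ψ x)
    (h : ¬ IsSquare (-1 : F)) {b e : F} (heb : e * b = 1) (hb : ψ (b ^ 9) ≠ 1) :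
    ∑ x, ∑ n, ψ (-e ^ 9 * (x ^ 5 + x ^ 3 * n - x * n ^ 2) + (e + e ^ 9) * x)
      = Fintype.card F := by
  classical
  have h3 := three_eq_zero_of_charP F
  have he0 : e ≠ 0 := left_ne_zero_of_mul_eq_one heb
  have h1 : ∀ x, ∑ n, ψ (-e ^ 9 * (x ^ 5 + x ^ 3 * n - x * n ^ 2) + (e + e ^ 9) * x)
      = ∑ n, ψ (e ^ 9 * x * n ^ 2 + (e ^ 9 * x ^ 5 + (e + e ^ 9) * x)) := by
    intro x
    rw [← Equiv.sum_comp (Equiv.subRight (x ^ 2))]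
    refine Finset.sum_congr rfl fun n _ => ?_
    rw [Equiv.subRight_apply]
    congr 1
    linear_combination (-e ^ 9 * x ^ 3 * n) * h3
  set G := ∑ y, ψ (e ^ 9 * y ^ 2) with hG
  have hG' : ∑ y, ψ (-(e ^ 9 * y ^ 2)) = -G :=
    sum_neg_quadratic_eq_neg hψ h (pow_ne_zero 9 he0)
  have h2 : ∀ ε u : F, ∑ n, ψ (e ^ 9 * (ε * u ^ 2) * n ^ 2
        + (e ^ 9 * (ε * u ^ 2) ^ 5 + (e + e ^ 9) * (ε * u ^ 2)))
      = ψ (e ^ 9 * (ε * u ^ 2) ^ 5 + (e + e ^ 9) * (ε * u ^ 2)) * ∑ y, ψ (ε * e ^ 9 * y ^ 2)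
        + if u = 0 then (Fintype.card F - ∑ y, ψ (ε * e ^ 9 * y ^ 2) : ℂ) else 0 := by
    intro ε u
    by_cases hu : u = 0
    · subst hu
      simp
    · rw [if_neg hu, add_zero, Finset.mul_sum,
        ← Equiv.sum_comp (Equiv.mulLeft₀ u hu)
          fun y => ψ (e ^ 9 * (ε * u ^ 2) ^ 5 + (e + e ^ 9) * (ε * u ^ 2))
            * ψ (ε * e ^ 9 * y ^ 2)]
      refine Finset.sum_congr rfl fun n _ => ?_
      rw [← AddChar.map_add_eq_mul]
      congr 1
      change _ = _ + ε * e ^ 9 * (u * n) ^ 2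
      ring
  have h4 : ∀ ε : F, ε ^ 2 = 1 → ∑ u, ∑ n, ψ (e ^ 9 * (ε * u ^ 2) * n ^ 2
        + (e ^ 9 * (ε * u ^ 2) ^ 5 + (e + e ^ 9) * (ε * u ^ 2)))
      = (1 + 2 * ψ (-(ε * b ^ 9))) * (∑ y, ψ (ε * e ^ 9 * y ^ 2)) ^ 2
        + (Fintype.card F - ∑ y, ψ (ε * e ^ 9 * y ^ 2)) := by
    intro ε hε
    rw [Finset.sum_congr rfl fun u _ => h2 ε u, Finset.sum_add_distrib, ← Finset.sum_mul]
    congr 1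
    · rw [pow_two, ← mul_assoc, ← sum_even_decic_eq hψ hF h heb hε]
      congr 1
      refine Finset.sum_congr rfl fun u _ => congrArg ψ ?_
      linear_combination e ^ 9 * u ^ 10 * ε * (ε ^ 2 + 1) * hε
    · simp
  have h5 := h4 1 (by ring)
  have h6 := h4 (-1) (by ring)
  simp only [one_mul, neg_mul, neg_neg, ← hG, hG'] at h5 h6
  have h7 := sum_sq_add_sum_neg_sq h fun x =>
    ∑ n, ψ (e ^ 9 * x * n ^ 2 + (e ^ 9 * x ^ 5 + (e + e ^ 9) * x))
  simp only [mul_neg, neg_mul] at h7 h6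
  rw [h5, h6] at h7
  rw [Finset.sum_congr rfl fun x _ => h1 x]
  linear_combination -h7 / 2 + G ^ 2 * AddChar.one_add_add_eq_zero hb

/-- A sum over pairs, rewritten in terms of half-sums and half-differences. -/
lemma sum_quintic_sq_add_eq (h : ¬ IsSquare (-1 : F)) (e : F) :
    (∑ v, ψ (-e ^ 9 * v ^ 5 + (e + e ^ 9) * v)) ^ 2
      + ∑ x, ∑ y, ψ (-e ^ 9 * (x ^ 5 + x ^ 3 * -y ^ 2 - x * (-y ^ 2) ^ 2) + (e + e ^ 9) * x)
      = 2 * ∑ x, ∑ n, ψ (-e ^ 9 * (x ^ 5 + x ^ 3 * n - x * n ^ 2) + (e + e ^ 9) * x) := by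
  have h3 := three_eq_zero_of_charP F
  have h1 : ∑ v, ψ (-e ^ 9 * v ^ 5 + (e + e ^ 9) * v)
      = ∑ v, ψ (-(-e ^ 9 * v ^ 5 + (e + e ^ 9) * v)) := by
    rw [← Equiv.sum_comp (Equiv.neg F)]
    refine Finset.sum_congr rfl fun v _ => congrArg ψ ?_
    rw [Equiv.neg_apply]
    ring
  let σ : F × F ≃ F × F :=
    { toFun := fun p => (p.1 + p.2, p.1 - p.2)
      invFun := fun p => (-(p.1 + p.2), -(p.1 - p.2))
      left_inv := fun p => by ext <;> simp <;> grind
      right_inv := fun p => by ext <;> simp <;> grind }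
  have h2 : (∑ v, ψ (-e ^ 9 * v ^ 5 + (e + e ^ 9) * v)) ^ 2
      = ∑ x, ∑ y, ψ (-e ^ 9 * (x ^ 5 + x ^ 3 * y ^ 2 - x * (y ^ 2) ^ 2) + (e + e ^ 9) * x) := by
    rw [h1, pow_two, Finset.sum_mul_sum, ← Fintype.sum_prod_type', ← Fintype.sum_prod_type',
      ← Equiv.sum_comp σ]
    refine Finset.sum_congr rfl fun p _ => ?_
    rw [← AddChar.map_add_eq_mul]
    congr 1
    simp only [σ, Equiv.coe_fn_mk]
    grind
  rw [h2, ← Finset.sum_add_distrib, Finset.mul_sum]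
  refine Finset.sum_congr rfl fun x _ => ?_
  exact sum_sq_add_sum_neg_sq h
    fun n => ψ (-e ^ 9 * (x ^ 5 + x ^ 3 * n - x * n ^ 2) + (e + e ^ 9) * x)

lemma exists_cube_sub_eq (hψ : ψ.IsPrimitive) (hF : ∀ x, ψ (x ^ 3) = ψ x) {a : F}
    (ha : ψ a = 1) : ∃ w, w ^ 3 - w = a := by
  classical
  by_contra! hne
  have h := sum_comp_cube_sub hψ hF (β := 1) (δ := 1) (by ring) fun y => if y = a then 1 else 0
  simp only [one_mul, mul_ite, mul_one, mul_zero, Finset.sum_ite_eq', Finset.mem_univ, if_true,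
    AddChar.map_neg_eq_sq, ha, hne, if_false, Finset.sum_const_zero] at h
  norm_num at h

lemma apply_ne_one_of_sum_pow_ne_zero (hψ : ψ.IsPrimitive) (hF : ∀ x, ψ (x ^ 3) = ψ x) {d : ℕ}
    (hd : Fintype.card F = 3 ^ d) {a : F} (ha : ∑ i ∈ Finset.range d, a ^ 3 ^ i ≠ 0) :
    ψ a ≠ 1 := by
  intro h
  obtain ⟨w, rfl⟩ := exists_cube_sub_eq hψ hF h
  apply ha
  have h1 : ∀ i, (w ^ 3 - w) ^ 3 ^ i = w ^ 3 ^ (i + 1) - w ^ 3 ^ i := by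
    intro i
    rw [sub_pow_char_pow, ← pow_mul, pow_succ' 3 i]
  rw [Finset.sum_congr rfl fun i _ => h1 i, Finset.sum_range_sub fun i => w ^ 3 ^ i, ← hd,
    FiniteField.pow_card, pow_zero, pow_one, sub_self]

variable (F) in
/-- The trace to the prime field gives a primitive additive character invariant under
Frobenius. -/
lemma exists_primitive_addChar_cube_invariant :
    ∃ ψ : AddChar F ℂ, ψ.IsPrimitive ∧ ∀ x, ψ (x ^ 3) = ψ x := by
  have : Fact (Nat.Prime 3) := ⟨Nat.prime_three⟩
  let _ : Algebra (ZMod 3) F := ZMod.algebra F 3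
  refine ⟨(ZMod.stdAddChar (N := 3)).compAddMonoidHom (Algebra.trace (ZMod 3) F).toAddMonoidHom,
    AddChar.IsPrimitive.of_ne_one fun h => ?_, fun x => ?_⟩
  · obtain ⟨x, hx⟩ := Algebra.trace_surjective (ZMod 3) F 1
    have h1 := DFunLike.congr_fun h x
    rw [AddChar.compAddMonoidHom_apply, AddChar.one_apply, LinearMap.toAddMonoidHom_coe, hx,
      ← AddChar.map_zero_eq_one (ZMod.stdAddChar (N := 3))] at h1
    exact one_ne_zero (ZMod.injective_stdAddChar h1)
  · simp only [AddChar.compAddMonoidHom_apply, LinearMap.toAddMonoidHom_coe]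
    congr 1
    exact Algebra.trace_eq_of_algEquiv (FiniteField.frobeniusAlgEquiv (ZMod 3) F 3) x

end CharSums

section QuadraticExtension

variable {K L : Type*} [Field K] [Field L] [Algebra K L] {I : L} {ψ : AddChar L ℂ}

lemma apply_eq_apply_of_eq_add_mul (hψI : ∀ y : K, ψ (I * algebraMap K L y) = 1) {z : L} {x : K}
    (y : K) (hz : z = algebraMap K L x + I * algebraMap K L y) :
    ψ z = ψ.compAddMonoidHom (algebraMap K L).toAddMonoidHom x := by
  rw [hz, AddChar.map_add_eq_mul, hψI, mul_one]
  rfl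

variable [Fintype K] [Fintype L]

lemma sum_eq_sum_sum_add_mul (hI : I ^ 2 = -1) (h : ¬ IsSquare (-1 : K))
    (hc : Fintype.card L = Fintype.card K ^ 2) (f : L → ℂ) :
    ∑ z, f z = ∑ x : K, ∑ y : K, f (algebraMap K L x + I * algebraMap K L y) := by
  have hinj : Function.Injective fun p : K × K => algebraMap K L p.1 + I * algebraMap K L p.2 := by
    rintro ⟨x, y⟩ ⟨x', y'⟩ hp
    have h1 : algebraMap K L (x - x') = I * algebraMap K L (y' - y) := by
      simp only [map_sub]
      linear_combination hp
    have h2 : (x - x') ^ 2 = -(y' - y) ^ 2 := by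
      apply (algebraMap K L).injective
      rw [map_pow, h1, map_neg, map_pow, mul_pow, hI, neg_one_mul]
    have h3 : y' - y = 0 := by
      by_contra h0
      refine h ⟨(x - x') / (y' - y), ?_⟩
      field_simp
      linear_combination -h2
    have h4 : x - x' = 0 := by
      rw [h3] at h2
      exact pow_eq_zero_iff two_ne_zero |>.1 (by simpa using h2)
    rw [sub_eq_zero.1 h3, sub_eq_zero.1 h4]
  have hbij := (Fintype.bijective_iff_injective_and_card _).2
    ⟨hinj, by rw [Fintype.card_prod, hc, pow_two]⟩
  rw [← Fintype.sum_prod_type', ← hbij.sum_comp f]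

lemma isPrimitive_restrict (hψ : ψ.IsPrimitive) (hI : I ^ 2 = -1) (h : ¬ IsSquare (-1 : K))
    (hc : Fintype.card L = Fintype.card K ^ 2)
    (hψI : ∀ y : K, ψ (I * algebraMap K L y) = 1) :
    (ψ.compAddMonoidHom (algebraMap K L).toAddMonoidHom).IsPrimitive := by
  classical
  refine AddChar.IsPrimitive.of_ne_one fun h1 => ?_
  have h2 := AddChar.sum_mulShift 1 hψ
  rw [sum_eq_sum_sum_add_mul hI h hc] at h2
  have h3 : ∀ x y : K, ψ ((algebraMap K L x + I * algebraMap K L y) * 1) = 1 := by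
    intro x y
    rw [mul_one, apply_eq_apply_of_eq_add_mul hψI y rfl, h1, AddChar.one_apply]
  simp only [h3] at h2
  simp at h2

variable [CharP K 3] [CharP L 3]

lemma sum_quadratic_one_add_mul_eq (hψ : ψ.IsPrimitive) (hI : I ^ 2 = -1)
    (h : ¬ IsSquare (-1 : K)) (hc : Fintype.card L = Fintype.card K ^ 2)
    (hψI : ∀ y : K, ψ (I * algebraMap K L y) = 1) {κ : K} (hκ : κ ≠ 0) :
    ∑ z, ψ ((1 + I) * algebraMap K L κ * z ^ 2) = -(Fintype.card K : ℂ) := by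
  have h3 := three_eq_zero_of_charP L
  rw [sum_eq_sum_sum_add_mul hI h hc,
    ← sum_quadratic_sq_eq_neg_card (isPrimitive_restrict hψ hI h hc hψI) h hκ]
  set φ := ψ.compAddMonoidHom (algebraMap K L).toAddMonoidHom with hφ
  have h1 : ∀ x y : K, ψ ((1 + I) * algebraMap K L κ
      * (algebraMap K L x + I * algebraMap K L y) ^ 2) = φ (κ * (x - y) ^ 2) * φ (κ * y ^ 2) := by
    intro x y
    rw [← AddChar.map_add_eq_mul, hφ]
    refine apply_eq_apply_of_eq_add_mul hψI (κ * (x ^ 2 - y ^ 2 + 2 * x * y)) ?_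
    simp only [map_add, map_mul, map_sub, map_pow, map_ofNat]
    grind
  simp only [h1]
  rw [Finset.sum_comm, pow_two, Finset.mul_sum]
  refine Finset.sum_congr rfl fun y _ => ?_
  rw [← Finset.sum_mul]
  congr 1
  exact Equiv.sum_comp (Equiv.subRight y) fun x => φ (κ * x ^ 2)

lemma sum_quintic_eq_two_mul_card (hψ : ψ.IsPrimitive) (hF : ∀ x, ψ (x ^ 3) = ψ x)
    (hI : I ^ 2 = -1) (h : ¬ IsSquare (-1 : K)) (hc : Fintype.card L = Fintype.card K ^ 2)
    (hψI : ∀ y : K, ψ (I * algebraMap K L y) = 1) {b e : K} (heb : e * b = 1)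
    (hb : ψ (algebraMap K L (b ^ 3)) ≠ 1) :
    ∑ v, ψ (-(algebraMap K L e) ^ 9 * v ^ 5
      + (algebraMap K L e + (algebraMap K L e) ^ 9) * v) = 2 * Fintype.card K := by
  have h3 := three_eq_zero_of_charP L
  have he : e ^ 9 ≠ 0 := pow_ne_zero 9 (left_ne_zero_of_mul_eq_one heb)
  have hψI' : ∀ y : K, ψ (-I * algebraMap K L y) = 1 := by
    intro y
    rw [neg_mul, AddChar.map_neg_eq_sq, hψI, one_pow]
  have hcube : (1 + I) ^ 3 = 1 + -I := by grind
  have hω : ∀ y : K, ψ ((1 + I) * algebraMap K L y) = ψ (algebraMap K L y) := by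
    intro y
    rw [add_mul, one_mul, AddChar.map_add_eq_mul, hψI, mul_one]
  have hb9 : ψ (algebraMap K L b ^ 9) = ψ (algebraMap K L b ^ 3) := by
    rw [← hF (algebraMap K L b ^ 3)]; congr 1; ring
  rw [sum_quintic_eq_of_pow_four_eq_neg_one hψ hF (ζ := 1 + I) (b := algebraMap K L b)
    (g := -(Fintype.card K : ℂ))]
  · ring
  · grind
  · rw [← map_mul, heb, map_one]
  · rw [← map_pow]
    exact sum_quadratic_one_add_mul_eq hψ hI h hc hψI he
  · rw [← map_pow, hcube]
    exact sum_quadratic_one_add_mul_eq hψ (by rw [neg_sq, hI]) h hc hψI' he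
  · rwa [← map_pow, hω]
  · rw [← map_pow, ← map_pow, hω, hω, map_pow (algebraMap K L), map_pow (algebraMap K L), hb9]

lemma sum_quintic_eq_zero (hψ : ψ.IsPrimitive) (hF : ∀ x, ψ (x ^ 3) = ψ x)
    (hI : I ^ 2 = -1) (h : ¬ IsSquare (-1 : K)) (hc : Fintype.card L = Fintype.card K ^ 2)
    (hψI : ∀ y : K, ψ (I * algebraMap K L y) = 1) {b e : K} (heb : e * b = 1)
    (hb : ψ (algebraMap K L (b ^ 3)) ≠ 1) :
    ∑ v, ψ.compAddMonoidHom (algebraMap K L).toAddMonoidHom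
      (-e ^ 9 * v ^ 5 + (e + e ^ 9) * v) = 0 := by
  have h3 := three_eq_zero_of_charP L
  have hL := sum_quintic_eq_two_mul_card hψ hF hI h hc hψI heb hb
  set φ := ψ.compAddMonoidHom (algebraMap K L).toAddMonoidHom with hφ
  have hφF : ∀ x, φ (x ^ 3) = φ x := by
    intro x
    change ψ (algebraMap K L (x ^ 3)) = ψ (algebraMap K L x)
    rw [map_pow, hF]
  have hb9 : φ (b ^ 9) ≠ 1 := by
    rw [show b ^ 9 = (b ^ 3) ^ 3 by ring, hφF]
    exact hb
  have h1 := sum_sum_symmetric_quintic_eq_card (isPrimitive_restrict hψ hI h hc hψI) hφF h heb hb9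
  have h2 := sum_quintic_sq_add_eq (ψ := φ) h e
  have h4 : ∀ x y : K, ψ (-(algebraMap K L e) ^ 9 * (algebraMap K L x + I * algebraMap K L y) ^ 5
      + (algebraMap K L e + (algebraMap K L e) ^ 9) * (algebraMap K L x + I * algebraMap K L y))
      = φ (-e ^ 9 * (x ^ 5 + x ^ 3 * -y ^ 2 - x * (-y ^ 2) ^ 2) + (e + e ^ 9) * x) := by
    intro x y
    refine apply_eq_apply_of_eq_add_mul hψI
      (-e ^ 9 * (5 * x ^ 4 * y - 10 * x ^ 2 * y ^ 3 + y ^ 5) + (e + e ^ 9) * y) ?_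
    simp only [map_add, map_mul, map_sub, map_pow, map_ofNat, map_neg]
    grind
  rw [sum_eq_sum_sum_add_mul hI h hc] at hL
  simp only [h4] at hL
  rw [hL, h1] at h2
  exact pow_eq_zero_iff two_ne_zero |>.1 (by linear_combination h2)

end QuadraticExtension


/-- For `q = 3^d` with `d` odd and `a ∈ F_q` with `Tr_{F_q/F_3}(a) ≠ 0`, the genus-2 curve
`y² = z⁶ + a²z³ + a²z + a⁴ + 1` has `q - 1` affine points over `F_q` and `q² + 2q - 1`
affine points over `F_{q²}` (so its Weil polynomial is `x⁴ + qx² + q²`). -/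
theorem stmt_18 (d : ℕ) (hd : Odd d) (q : ℕ) (hq : q = 3 ^ d)
    (K : Type*) [Field K] [Fintype K] (hK : Fintype.card K = q)
    (a : K) (ha : ∑ i ∈ Finset.range d, a ^ 3 ^ i ≠ 0)
    (L : Type*) [Field L] [Fintype L] [Algebra K L] (hL : Fintype.card L = q ^ 2) :
    (Nat.card {P : K × K //
        P.2 ^ 2 = P.1 ^ 6 + a ^ 2 * P.1 ^ 3 + a ^ 2 * P.1 + a ^ 4 + 1} : ℤ)
      = (q : ℤ) - 1 ∧
    (Nat.card {P : L × L //
        P.2 ^ 2 = P.1 ^ 6 + (algebraMap K L a) ^ 2 * P.1 ^ 3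
          + (algebraMap K L a) ^ 2 * P.1 + (algebraMap K L a) ^ 4 + 1} : ℤ)
      = (q : ℤ) ^ 2 + 2 * q - 1 := by
  have hd0 : d ≠ 0 := by rintro rfl; simp at hd
  have hK3 : Fintype.card K = 3 ^ d := hK.trans hq
  have hL3 : Fintype.card L = 3 ^ (d * 2) := by rw [hL, hq, pow_mul]
  have : Fact (Nat.Prime 3) := ⟨Nat.prime_three⟩
  have : CharP K 3 := charP_of_card_eq_prime_pow hK3
  have : CharP L 3 := charP_of_card_eq_prime_pow hL3
  have hmod : 3 ^ d % 4 = 3 := by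
    obtain ⟨k, rfl⟩ := hd
    rw [pow_succ, pow_mul, Nat.mul_mod, Nat.pow_mod]
    norm_num
  have hsq : ¬ IsSquare (-1 : K) := by
    rw [FiniteField.isSquare_neg_one_iff, hK3, hmod]
    simp
  have hsqL : IsSquare (-1 : L) := by
    rw [FiniteField.isSquare_neg_one_iff, hL3, pow_mul, Nat.pow_mod, hmod]
    norm_num
  obtain ⟨I, hI⟩ := hsqL
  rw [← pow_two, eq_comm] at hI
  have hc : Fintype.card L = Fintype.card K ^ 2 := by rw [hL, hK]
  obtain ⟨ψ, hψ, hF⟩ := exists_primitive_addChar_cube_invariant L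
  have hFn : ∀ (n : ℕ) (x : L), ψ (x ^ 3 ^ n) = ψ x := by
    intro n x
    induction n with
    | zero => simp
    | succ n ih => rw [pow_succ, pow_mul, hF, ih]
  have hψI : ∀ y : K, ψ (I * algebraMap K L y) = 1 := by
    intro y
    have hIq : I ^ 3 ^ d = -I := by
      rw [← Nat.div_add_mod (3 ^ d) 4, hmod, pow_add, pow_mul,
        show I ^ 4 = 1 by linear_combination (I ^ 2 - 1) * hI, one_pow, one_mul]
      linear_combination I * hI
    have h1 := hFn d (I * algebraMap K L y)
    rw [mul_pow, hIq, ← map_pow, ← hK3, FiniteField.pow_card, neg_mul,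
      AddChar.map_neg_eq_sq] at h1
    apply mul_right_cancel₀ (AddChar.apply_ne_zero (ψ := ψ) (I * algebraMap K L y))
    linear_combination h1
  have hφ := isPrimitive_restrict hψ hI hsq hc hψI
  have hφF : ∀ x, ψ.compAddMonoidHom (algebraMap K L).toAddMonoidHom (x ^ 3)
      = ψ.compAddMonoidHom (algebraMap K L).toAddMonoidHom x := by
    intro x
    change ψ (algebraMap K L (x ^ 3)) = ψ (algebraMap K L x)
    rw [map_pow, hF]
  have hψa : ψ (algebraMap K L a) ≠ 1 := apply_ne_one_of_sum_pow_ne_zero hφ hφF hK3 ha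
  obtain ⟨b, rfl⟩ : ∃ b, b ^ 3 = a :=
    (Finite.injective_iff_surjective.1 (cube_injective_of_charP K)) a
  have hb : b ≠ 0 := by
    rintro rfl
    simp at hψa
  have heb : b⁻¹ * b = 1 := inv_mul_cancel₀ hb
  constructor
  · have h1 := card_curve_eq hφ hφF rfl heb
    rw [sum_quintic_eq_zero hψ hF hI hsq hc hψI heb hψa, hK, add_zero] at h1
    exact_mod_cast h1
  · have h1 := card_curve_eq hψ hF (a := algebraMap K L (b ^ 3)) (map_pow _ _ _)
      (e := algebraMap K L b⁻¹) (by rw [← map_mul, heb, map_one])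
    rw [sum_quintic_eq_two_mul_card hψ hF hI hsq hc hψI heb hψa, hL, hK] at h1
    have h2 : ((q ^ 2 : ℕ) : ℂ) - 1 + 2 * q = (((q : ℤ) ^ 2 + 2 * q - 1 : ℤ) : ℂ) := by
      push_cast
      ring
    rw [h2] at h1
    exact_mod_cast h1
end

section
/- Let q = 3^d with d odd, let K be a finite field with q elements, and let a ∈ K be a nonzero element with Tr_{K/F_3}(a) = 0. Then the number of pairs (z, y) ∈ K × K with y^2 = z^6 + a^2 z^3 + a^2 z + a^4 + 1 equals q − 1, and the number of pairs (z, y) ∈ L × L with y^2 = z^6 + a^2 z^3 + a^2 z + a^4 + 1, where L is a field with q^2 elements containing K, equals q^2 − 4q − 1. (These counts express that the genus-2 curve y^2 = z^6 + a^2 z^3 + a^2 z + a^4 + 1 over F_q has Weil polynomial x^4 − 2q x^2 + q^2.) -/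
open Finset

/-- In characteristic three, the substitution `y = u + z³` turns the equation of the curve into one
that is additive in `z`; orthogonality then gives the number of its affine points as a
character sum. -/
theorem card_curve_eq_charSum {F : Type*} [Field F] [Fintype F] [CharP F 3]
    {ψ : AddChar F ℂ} (hψ : ψ.IsPrimitive) (hψ3 : ∀ x, ψ (x ^ 3) = ψ x)
    {a b : F} (hab : a * b = 1) :
    (Nat.card {P : F × F //
        P.2 ^ 2 = P.1 ^ 6 + a ^ 2 * P.1 ^ 3 + a ^ 2 * P.1 + a ^ 4 + 1} : ℂ)
      = Fintype.card F - 1 + ∑ w, ψ (-(b ^ 3 * w ^ 5) + b * w ^ 3 + b ^ 3 * w) := by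
  classical
  have h3 : (3 : F) = 0 := CharP.cast_eq_zero F 3
  have hq : (Fintype.card F : ℂ) ≠ 0 := by simp
  have hb : b ≠ 0 := right_ne_zero_of_mul_eq_one hab
  have hcube : Function.Bijective fun z : F => z ^ 3 :=
    Finite.injective_iff_bijective.mp (frobenius_inj F 3)
  have hcount : (Nat.card {P : F × F //
        P.2 ^ 2 = P.1 ^ 6 + a ^ 2 * P.1 ^ 3 + a ^ 2 * P.1 + a ^ 4 + 1} : ℂ)
      = ∑ z : F, ∑ u : F,
        if (u + a ^ 2) * z ^ 3 + a ^ 2 * z - (u ^ 2 - a ^ 4 - 1) = 0 then (1 : ℂ) else 0 := by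
    rw [Nat.card_eq_fintype_card, Fintype.card_subtype, Finset.card_filter, Nat.cast_sum,
      Fintype.sum_prod_type]
    refine Finset.sum_congr rfl fun z _ => ?_
    rw [← Equiv.sum_comp (Equiv.addRight (z ^ 3))]
    refine Finset.sum_congr rfl fun u _ => ?_
    rw [Equiv.coe_addRight]
    push_cast
    refine if_congr ⟨fun h => ?_, fun h => ?_⟩ rfl rfl
    · linear_combination -h + u * z ^ 3 * h3
    · linear_combination -h + u * z ^ 3 * h3
  have hsplit (z u t : F) :
      ψ (t * ((u + a ^ 2) * z ^ 3 + a ^ 2 * z - (u ^ 2 - a ^ 4 - 1)))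
        = ψ (-t * (u ^ 2 - a ^ 4 - 1)) * ψ (z ^ 3 * (t * (u + a ^ 2) + t ^ 3 * a ^ 6)) := by
    have : ψ (z ^ 3 * (t * (u + a ^ 2) + t ^ 3 * a ^ 6))
        = ψ (z ^ 3 * (t * (u + a ^ 2))) * ψ (t * a ^ 2 * z) := by
      rw [← hψ3 (t * a ^ 2 * z), ← AddChar.map_add_eq_mul]
      ring_nf
    rw [this, ← AddChar.map_add_eq_mul, ← AddChar.map_add_eq_mul]
    ring_nf
  have hmain : (Nat.card {P : F × F //
        P.2 ^ 2 = P.1 ^ 6 + a ^ 2 * P.1 ^ 3 + a ^ 2 * P.1 + a ^ 4 + 1} : ℂ)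
      = ∑ t : F, ∑ u : F, if t * (u + a ^ 2) + t ^ 3 * a ^ 6 = 0
          then ψ (-t * (u ^ 2 - a ^ 4 - 1)) else 0 := by
    refine mul_left_cancel₀ hq ?_
    calc _ = ∑ z : F, ∑ u : F, ∑ t : F,
          ψ (t * ((u + a ^ 2) * z ^ 3 + a ^ 2 * z - (u ^ 2 - a ^ 4 - 1))) := by
          rw [hcount, Finset.mul_sum]
          refine Finset.sum_congr rfl fun z _ => ?_
          rw [Finset.mul_sum]
          refine Finset.sum_congr rfl fun u _ => ?_
          rw [AddChar.sum_mulShift _ hψ]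
          split_ifs <;> simp
      _ = ∑ t : F, ∑ u : F, ∑ z : F,
          ψ (t * ((u + a ^ 2) * z ^ 3 + a ^ 2 * z - (u ^ 2 - a ^ 4 - 1))) := by
          rw [Finset.sum_comm]
          simp_rw [fun u : F => Finset.sum_comm (s := (univ : Finset F)) (t := univ)
            (f := fun z t => ψ (t * ((u + a ^ 2) * z ^ 3 + a ^ 2 * z - (u ^ 2 - a ^ 4 - 1))))]
          rw [Finset.sum_comm]
      _ = _ := by
          rw [Finset.mul_sum]
          refine Finset.sum_congr rfl fun t _ => ?_
          rw [Finset.mul_sum]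
          refine Finset.sum_congr rfl fun u _ => ?_
          simp_rw [hsplit]
          rw [← Finset.mul_sum,
            hcube.sum_comp fun z => ψ (z * (t * (u + a ^ 2) + t ^ 3 * a ^ 6)),
            AddChar.sum_mulShift _ hψ]
          split_ifs <;> simp [mul_comm]
  have hinner (t : F) : (∑ u : F, if t * (u + a ^ 2) + t ^ 3 * a ^ 6 = 0
          then ψ (-t * (u ^ 2 - a ^ 4 - 1)) else 0)
      = ψ (-(a ^ 12 * t ^ 5) + a ^ 8 * t ^ 3 + t)
        + if t = 0 then (Fintype.card F : ℂ) - 1 else 0 := by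
    by_cases ht : t = 0
    · simp [ht]
    · have (u : F) : t * (u + a ^ 2) + t ^ 3 * a ^ 6 = 0 ↔ u = -a ^ 2 - t ^ 2 * a ^ 6 := by
        rw [show t * (u + a ^ 2) + t ^ 3 * a ^ 6 = t * (u - (-a ^ 2 - t ^ 2 * a ^ 6)) by ring,
          mul_eq_zero, or_iff_right ht, sub_eq_zero]
      simp only [this, Finset.sum_ite_eq', Finset.mem_univ, if_true, ht, if_false, add_zero]
      congr 1
      linear_combination (-a ^ 8 * t ^ 3) * h3
  rw [hmain]
  simp_rw [hinner]
  rw [Finset.sum_add_distrib, Finset.sum_ite_eq' univ (0 : F), if_pos (mem_univ _), add_comm]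
  congr 1
  rw [← Equiv.sum_comp (Equiv.mulLeft₀ (b ^ 3) (pow_ne_zero 3 hb))]
  refine Finset.sum_congr rfl fun w _ => congrArg ψ ?_
  obtain rfl : a = b⁻¹ := eq_inv_of_mul_eq_one_left hab
  simp only [Equiv.mulLeft₀_apply]
  field_simp

/-- Every element is hit twice by the two maps `x ↦ x²` and `x ↦ n x²` together, where `n` is
not a square. -/
theorem sum_sq_add_sum_nonsquare_mul_sq {F : Type*} [Field F] [Fintype F]
    (hF : ringChar F ≠ 2) {n : F} (hn : ¬ IsSquare n) (f : F → ℂ) :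
    ∑ x, f (x ^ 2) + ∑ x, f (n * x ^ 2) = 2 * ∑ w, f w := by
  classical
  have hn0 : n ≠ 0 := by rintro rfl; exact hn IsSquare.zero
  have key (g : F → ℂ) : ∑ x, g (x ^ 2) = ∑ w, ((quadraticChar F w : ℤ) + 1 : ℂ) * g w := by
    rw [← Finset.sum_fiberwise univ (fun x : F => x ^ 2)]
    refine Finset.sum_congr rfl fun w _ => ?_
    rw [Finset.sum_congr rfl (g := fun _ => g w)
      (fun x hx => by rw [(Finset.mem_filter.mp hx).2]), Finset.sum_const, nsmul_eq_mul]
    congr 1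
    have := quadraticChar_card_sqrts hF w
    rw [Set.toFinset_ofPred] at this
    exact_mod_cast this
  rw [key, key fun w => f (n * w), ← Equiv.sum_comp (Equiv.mulLeft₀ n hn0)
    (fun w => ((quadraticChar F w : ℤ) + 1 : ℂ) * f w), ← Equiv.sum_comp (Equiv.mulLeft₀ n hn0) f,
    ← Finset.sum_add_distrib, Finset.mul_sum]
  refine Finset.sum_congr rfl fun w _ => ?_
  simp only [Equiv.mulLeft₀_apply, map_mul, quadraticChar_neg_one_iff_not_isSquare.mpr hn]
  push_cast
  ring

/-- The squared absolute value of the Gauss sum of a quadratic form `A`, whose polarization is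
represented by `R`, in terms of its radical. -/
theorem gaussSum_mul_gaussSum_neg {F : Type*} [Field F] [Fintype F] [CharP F 3]
    {ψ : AddChar F ℂ} (hψ : ψ.IsPrimitive) {A R : F → F}  (hAneg : ∀ x, A (-x) = A x)
    (hA : ∀ x y, ψ (A (x + y)) = ψ (A x) * ψ (A y) * ψ (y ^ 9 * R x)) :
    (∑ x, ψ (A x)) * ∑ x, ψ (-A x) = Fintype.card F * Nat.card {x // R x = 0} := by
  classical
  have hpow : Function.Bijective fun z : F => z ^ 9 := by
    have := Finite.injective_iff_bijective.mp (iterateFrobenius_inj F 3 2)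
    exact this
  have hrad (x : F) (hx : R x = 0) : ψ (A x) = 1 := by
    have h := hA x x
    have h3 : (3 : F) = 0 := CharP.cast_eq_zero F 3
    rw [show x + x = -x by linear_combination x * h3, hAneg, hx, mul_zero, AddChar.map_zero_eq_one,
      mul_one] at h
    exact mul_left_cancel₀ (ψ.val_isUnit (A x)).ne_zero (by rw [← h, mul_one])
  calc _ = ∑ y, ∑ x, ψ (A (x + y)) * ψ (-A y) := by
        rw [Finset.sum_mul_sum, Finset.sum_comm]
        refine Finset.sum_congr rfl fun y _ => ?_
        exact (Equiv.sum_comp (Equiv.addRight y) fun x => ψ (A x) * ψ (-A y)).symm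
    _ = ∑ x, ψ (A x) * ∑ y, ψ (y ^ 9 * R x) := by
        rw [Finset.sum_comm]
        refine Finset.sum_congr rfl fun x _ => ?_
        rw [Finset.mul_sum]
        refine Finset.sum_congr rfl fun y _ => ?_
        have : ψ (A y) * ψ (-A y) = 1 := by
          rw [← AddChar.map_add_eq_mul, add_neg_cancel, AddChar.map_zero_eq_one]
        rw [hA]
        linear_combination ψ (A x) * ψ (y ^ 9 * R x) * this
    _ = ∑ x, if R x = 0 then (Fintype.card F : ℂ) else 0 := by
        refine Finset.sum_congr rfl fun x _ => ?_
        rw [hpow.sum_comp fun y => ψ (y * R x), AddChar.sum_mulShift _ hψ]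
        split_ifs with h <;> simp [hrad, h]
    _ = _ := by
        rw [← Finset.sum_filter, Finset.sum_const, nsmul_eq_mul, Nat.card_eq_fintype_card,
          Fintype.card_subtype, mul_comm]

theorem Int.eq_zero_of_sq_add_three_mul_sq_eq_pow {k : ℕ} (hk : Odd k) {p t : ℤ}
    (h : p ^ 2 + 3 * t ^ 2 = 3 ^ k) : p = 0 := by
  obtain ⟨m, rfl⟩ := hk
  induction m generalizing p t with
  | zero =>
    have hp : (3 : ℤ) ∣ p :=
      Int.prime_three.dvd_of_dvd_pow (n := 2) ⟨1 - t ^ 2, by linear_combination h⟩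
    obtain ⟨r, rfl⟩ := hp
    have : r = 0 := by
      by_contra hr
      have : 0 < r ^ 2 := by positivity
      norm_num at h
      nlinarith [sq_nonneg t]
    simp [this]
  | succ m ih =>
    have hp : (3 : ℤ) ∣ p :=
      Int.prime_three.dvd_of_dvd_pow (n := 2)
        ⟨3 ^ (2 * m + 2) - t ^ 2, by linear_combination h⟩
    obtain ⟨r, rfl⟩ := hp
    have ht : (3 : ℤ) ∣ t :=
      Int.prime_three.dvd_of_dvd_pow (n := 2) ⟨3 ^ (2 * m + 1) - r ^ 2, by
        have h' : 3 * t ^ 2 = 3 * (3 * (3 ^ (2 * m + 1) - r ^ 2)) := by linear_combination h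
        linarith⟩
    obtain ⟨s, rfl⟩ := ht
    rw [ih (p := r) (t := s) (by
      have h' : 9 * (r ^ 2 + 3 * s ^ 2) = 9 * 3 ^ (2 * m + 1) := by linear_combination h
      linarith), mul_zero]

theorem even_card_filter_of_neg_invariant {F : Type*} [Field F] [Fintype F] (h2 : (2 : F) ≠ 0)
    {P : F → Prop} [DecidablePred P] (h0 : ¬ P 0) (hneg : ∀ x, P x → P (-x)) :
    Even #{x | P x} := by
  rw [← ZMod.natCast_eq_zero_iff_even, Finset.cast_card]
  refine Finset.sum_involution (fun x _ => -x) (fun _ _ => by decide) (fun x hx _ h => ?_)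
    (fun x hx => by simpa using hneg x (by simpa using hx)) (fun x _ => neg_neg x)
  have : 2 * x = 0 := by linear_combination -h
  have : x = 0 := by simpa [h2] using this
  exact h0 (by simpa [this] using hx)

/-- An even function with values in the cube roots of unity whose sum has norm an odd power of three
has purely imaginary sum: the sum is congruent to `1` modulo `2` in the Eisenstein integers. -/
theorem sum_add_sum_inv_eq_zero {F : Type*} [Field F] [Fintype F] (h2 : (2 : F) ≠ 0)
    {φ : F → ℂ} (h1 : ∀ x, φ x ^ 3 = 1) (h0 : φ 0 = 1) (hneg : ∀ x, φ (-x) = φ x)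
    {k : ℕ} (hk : Odd k) (hnorm : (∑ x, φ x) * ∑ x, (φ x)⁻¹ = 3 ^ k) :
    ∑ x, φ x + ∑ x, (φ x)⁻¹ = 0 := by
  classical
  obtain ⟨ω, hω⟩ : ∃ ω : ℂ, IsPrimitiveRoot ω 3 := ⟨_, Complex.isPrimitiveRoot_exp 3 (by norm_num)⟩
  have hω3 : ω ^ 3 = 1 := hω.pow_eq_one
  have hω1 : ω ≠ 1 := hω.ne_one (by norm_num)
  have hωs : ω ^ 2 + ω + 1 = 0 := by
    refine mul_left_cancel₀ (sub_ne_zero.mpr hω1) ?_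
    linear_combination hω3
  have hω2 : ω ^ 2 ≠ 1 := hω.pow_ne_one_of_pos_of_lt (by norm_num) (by norm_num)
  have hω0 : ω ≠ 0 := hω.ne_zero (by norm_num)
  have hω12 : ω ≠ ω ^ 2 := fun h => hω1 (mul_left_cancel₀ hω0 (by linear_combination -h))
  have hval (x : F) : φ x = 1 ∨ φ x = ω ∨ φ x = ω ^ 2 := by
    have : (φ x - 1) * ((φ x - ω) * (φ x - ω ^ 2)) = 0 := by
      linear_combination h1 x - (φ x ^ 2 - φ x) * hωs + (φ x - 1) * hω3
    simpa [sub_eq_zero] using this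
  have hsum (g : ℂ → ℂ) : ∑ x, g (φ x) = #{x | φ x = 1} * g 1 + #{x | φ x = ω} * g ω
      + #{x | φ x = ω ^ 2} * g (ω ^ 2) := by
    have (x : F) : g (φ x) = (if φ x = 1 then g 1 else 0) + (if φ x = ω then g ω else 0)
        + (if φ x = ω ^ 2 then g (ω ^ 2) else 0) := by
      rcases hval x with h | h | h
      · simp [h, hω1.symm, hω2.symm]
      · simp [h, hω1, hω12]
      · simp [h, hω2, hω12.symm]
    simp_rw [this, Finset.sum_add_distrib, ← Finset.sum_filter, Finset.sum_const, nsmul_eq_mul]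
  obtain ⟨y, hy⟩ := even_card_filter_of_neg_invariant h2 (P := fun x => φ x = ω)
    (by simpa [h0] using hω1.symm) (fun x hx => by rw [hneg, hx])
  obtain ⟨z, hz⟩ := even_card_filter_of_neg_invariant h2 (P := fun x => φ x = ω ^ 2)
    (by simpa [h0] using hω2.symm) (fun x hx => by rw [hneg, hx])
  have hS := hsum id
  have hS' := hsum fun c => c⁻¹
  have hinv : ω⁻¹ = ω ^ 2 := inv_eq_of_mul_eq_one_right (by linear_combination hω3)
  have hinv2 : (ω ^ 2)⁻¹ = ω := by rw [← hinv, inv_inv]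
  simp only [id, hinv, hinv2, inv_one, hy, hz] at hS hS'
  set x := #{x | φ x = 1}
  push_cast at hS hS'
  have hω4 : ω ^ 2 = -1 - ω := by linear_combination hωs
  rw [hω4] at hS hS'
  have hint : ((x : ℤ) - y - z) ^ 2 + 3 * ((y : ℤ) - z) ^ 2 = 3 ^ k := by
    have : (((x : ℂ) - y - z) ^ 2 + 3 * ((y : ℂ) - z) ^ 2) = 3 ^ k := by
      rw [← hnorm, hS, hS']
      linear_combination (4 * (y - z) ^ 2) * hωs
    exact_mod_cast this
  have hp : ((x : ℤ) : ℂ) - y - z = 0 := by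
    exact_mod_cast Int.eq_zero_of_sq_add_three_mul_sq_eq_pow hk hint
  rw [hS, hS']
  push_cast at hp
  linear_combination 2 * hp

theorem pow_nine_pow_of_pow_nine_eq_neg {M : Type*} [CommRing M] {x : M} (hx : x ^ 9 = -x)
    {m : ℕ} (hm : Odd m) : x ^ 9 ^ m = -x := by
  obtain ⟨k, rfl⟩ := hm
  induction k with
  | zero => simpa using hx
  | succ k ih =>
    rw [show 9 ^ (2 * (k + 1) + 1) = 9 ^ (2 * k + 1) * (9 * 9) by ring, pow_mul, ih, pow_mul,
      Odd.neg_pow (by decide), hx, neg_neg, hx]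

theorem pow_nine_pow_of_pow_nine_eq_self {M : Type*} [CommRing M] {x : M} (hx : x ^ 9 = x)
    (m : ℕ) : x ^ 9 ^ m = x := by
  induction m with
  | zero => simp
  | succ m ih => rw [pow_succ, pow_mul, ih, hx]

theorem pow_three_pow_of_pow_three_eq_neg {M : Type*} [CommRing M] {x : M} (hx : x ^ 3 = -x)
    {m : ℕ} (hm : Odd m) : x ^ 3 ^ m = -x := by
  obtain ⟨k, rfl⟩ := hm
  have h9 : x ^ 9 = x := by
    rw [show 9 = 3 * 3 by norm_num, pow_mul, hx, Odd.neg_pow (by decide), hx, neg_neg]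
  rw [pow_succ, pow_mul 3 2 k, pow_mul, show 3 ^ 2 = 9 by norm_num,
    pow_nine_pow_of_pow_nine_eq_self h9, hx]

theorem eq_zero_of_eq_neg_self_of_charP_three {F : Type*} [Field F] [CharP F 3] {x : F}
    (h : x = -x) : x = 0 := by
  have h3 : (3 : F) = 0 := CharP.cast_eq_zero F 3
  linear_combination x * h3 - h

theorem eq_zero_of_pow_nine_eq_neg {F : Type*} [Field F] [CharP F 3] {d : ℕ} (hd : Odd d)
    {x : F} (hF : x ^ 9 ^ d = x) (hx : x ^ 9 = -x) : x = 0 :=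
  eq_zero_of_eq_neg_self_of_charP_three <| hF.symm.trans (pow_nine_pow_of_pow_nine_eq_neg hx hd)

theorem pow_three_eq_self_of_pow_nine_eq_self {F : Type*} [Field F] {d : ℕ} (hd : Odd d)
    {x : F} (hF : x ^ 3 ^ d = x) (hx : x ^ 9 = x) : x ^ 3 = x := by
  obtain ⟨m, rfl⟩ := hd
  rwa [pow_succ, pow_mul 3 2 m, pow_mul, show 3 ^ 2 = 9 by norm_num,
    pow_nine_pow_of_pow_nine_eq_self hx] at hF

theorem eq_zero_or_one_or_neg_one_of_pow_three_eq_self {F : Type*} [Field F] {x : F}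
    (hx : x ^ 3 = x) : x = 0 ∨ x = 1 ∨ x = -1 := by
  have : x * ((x - 1) * (x + 1)) = 0 := by linear_combination hx
  simpa [sub_eq_zero, add_eq_zero_iff_eq_neg] using this

/-- The canonical additive character of a finite field of characteristic three. -/
theorem exists_addChar_of_card_eq_three_pow {F : Type*} [Field F] [Fintype F] [CharP F 3] {d : ℕ}
    (hF : Fintype.card F = 3 ^ d) :
    ∃ ψ : AddChar F ℂ, ψ.IsPrimitive ∧ (∀ x, ψ (x ^ 3) = ψ x) ∧
      ∀ a, ∑ i ∈ range d, a ^ 3 ^ i = 0 → ψ a = 1 := by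
  have : Fact (Nat.Prime 3) := ⟨Nat.prime_three⟩
  let _ : Algebra (ZMod 3) F := ZMod.algebra F 3
  have hinj := FaithfulSMul.algebraMap_injective (ZMod 3) F
  have hd : Module.finrank (ZMod 3) F = d := by
    have := Module.card_eq_pow_finrank (K := ZMod 3) (V := F)
    rw [hF, ZMod.card] at this
    exact (Nat.pow_right_injective (by norm_num : 2 ≤ 3) this).symm
  have htr (a : F) : algebraMap (ZMod 3) F (Algebra.trace (ZMod 3) F a)
      = ∑ i ∈ range d, a ^ 3 ^ i := by
    rw [FiniteField.algebraMap_trace_eq_sum_pow, hd, Nat.card_zmod]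
  let ψ₀ : AddChar (ZMod 3) ℂ := ZMod.stdAddChar
  have hψ₀ : Function.Injective ψ₀ := ZMod.injective_stdAddChar
  refine ⟨ψ₀.compAddMonoidHom (Algebra.trace (ZMod 3) F).toAddMonoidHom,
    AddChar.IsPrimitive.of_ne_one ?_, fun x => ?_, fun a ha => ?_⟩
  · obtain ⟨x, hx⟩ := Algebra.trace_surjective (ZMod 3) F 1
    refine AddChar.ne_one_iff.mpr ⟨x, fun h => ?_⟩
    have h' : ψ₀ (Algebra.trace (ZMod 3) F x) = ψ₀ 0 := by
      rw [AddChar.map_zero_eq_one]; exact h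
    exact one_ne_zero (hx.symm.trans (hψ₀ h'))
  · refine congrArg ψ₀ (hinj ?_)
    change algebraMap (ZMod 3) F (Algebra.trace (ZMod 3) F (x ^ 3))
      = algebraMap (ZMod 3) F (Algebra.trace (ZMod 3) F x)
    have hx : x ^ 3 ^ d = x := hF ▸ FiniteField.pow_card x
    rw [htr, htr]
    have h := Finset.sum_range_succ' (fun i => x ^ 3 ^ i) d
    rw [Finset.sum_range_succ, hx, pow_zero, pow_one] at h
    rw [add_right_cancel h]
    exact Finset.sum_congr rfl fun i _ => by rw [← pow_mul, pow_succ']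
  · have : Algebra.trace (ZMod 3) F a = 0 := hinj (by rw [htr, ha, map_zero])
    change ψ₀ (Algebra.trace (ZMod 3) F a) = 1
    rw [this, AddChar.map_zero_eq_one]

/-- Additive Hilbert 90. -/
theorem exists_pow_three_sub_eq_of_addChar_eq_one {F : Type*} [Field F] [Fintype F] [CharP F 3]
    {ψ : AddChar F ℂ} (hψ : ψ.IsPrimitive) (hψ3 : ∀ x, ψ (x ^ 3) = ψ x) {a : F}
    (ha : ψ a = 1) : ∃ t, t ^ 3 - t = a := by
  classical
  by_contra! hne
  have hcube : Function.Bijective fun z : F => z ^ 3 :=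
    Finite.injective_iff_bijective.mp (frobenius_inj F 3)
  have h1 : ∑ t : F, ∑ y : F, ψ (y * (t ^ 3 - t - a)) = 0 :=
    Finset.sum_eq_zero fun t _ => by
      rw [AddChar.sum_mulShift _ hψ, if_neg (sub_ne_zero.mpr (hne t)), Nat.cast_zero]
  have h2 (y : F) : ∑ t : F, ψ (y * (t ^ 3 - t - a))
      = if y - y ^ 3 = 0 then (Fintype.card F : ℂ) else 0 := by
    have (t : F) : ψ (y * (t ^ 3 - t - a)) = ψ (-(y * a)) * ψ (t ^ 3 * (y - y ^ 3)) := by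
      have h : ψ (-(y * t)) = ψ (-(y ^ 3 * t ^ 3)) := by
        rw [← hψ3 (-(y * t))]; ring_nf
      calc _ = ψ (-(y * a)) * (ψ (t ^ 3 * y) * ψ (-(y * t))) := by
            rw [← AddChar.map_add_eq_mul, ← AddChar.map_add_eq_mul]; ring_nf
        _ = _ := by
            rw [h, ← AddChar.map_add_eq_mul]; ring_nf
    simp_rw [this]
    rw [← Finset.mul_sum, hcube.sum_comp fun t => ψ (t * (y - y ^ 3)), AddChar.sum_mulShift _ hψ]
    split_ifs with hy
    · rcases eq_zero_or_one_or_neg_one_of_pow_three_eq_self (sub_eq_zero.mp hy).symm with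
        rfl | rfl | rfl <;> simp [ha, AddChar.map_neg_eq_inv]
    · simp
  rw [Finset.sum_comm, Finset.sum_congr rfl fun y _ => h2 y, ← Finset.sum_filter,
    Finset.sum_const, nsmul_eq_mul, mul_eq_zero, Nat.cast_eq_zero, Finset.card_eq_zero] at h1
  rcases h1 with h1 | h1
  · have : (0 : F) ∈ ({y | y - y ^ 3 = 0} : Finset F) := by simp
    simp [h1] at this
  · simp at h1

/-- The forms whose Gauss sums govern the point counts. -/
def decicForm {F : Type*} [Field F] (b ε x : F) : F :=
  ε * b ^ 3 * x ^ 10 + b * x ^ 6 + b ^ 3 * x ^ 2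

def decicRadical {F : Type*} [Field F] (b ε x : F) : F :=
  ε * (b ^ 27 * x ^ 81 + b ^ 3 * x) - (b ^ 3 + b ^ 27) * x ^ 9

section CharThree

variable {F : Type*} [Field F] [CharP F 3]

theorem add_pow_three_of_charP (x y : F) : (x + y) ^ 3 = x ^ 3 + y ^ 3 :=
  add_pow_expChar x y 3

theorem add_pow_nine_of_charP (x y : F) : (x + y) ^ 9 = x ^ 9 + y ^ 9 :=
  add_pow_expChar_pow x y 3 2

theorem decicForm_add (b ε x y : F) : decicForm b ε (x + y) = decicForm b ε x + decicForm b ε y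
    + (ε * b ^ 3 * (x ^ 9 * y + x * y ^ 9) - b * (x ^ 3 * y ^ 3) - b ^ 3 * (x * y)) := by
  have h3 : (3 : F) = 0 := CharP.cast_eq_zero F 3
  have h10 : (x + y) ^ 10 = (x ^ 9 + y ^ 9) * (x + y) := by
    rw [← add_pow_nine_of_charP]; ring
  have h6 : (x + y) ^ 6 = (x ^ 3 + y ^ 3) ^ 2 := by
    rw [← add_pow_three_of_charP]; ring
  rw [decicForm, h10, h6, decicForm, decicForm]
  linear_combination (b * x ^ 3 * y ^ 3 + b ^ 3 * x * y) * h3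

theorem addChar_decicForm_add {ψ : AddChar F ℂ} (hψ3 : ∀ x, ψ (x ^ 3) = ψ x) {b ε : F}
    (hε : ε ^ 3 = ε) (x y : F) :
    ψ (decicForm b ε (x + y))
      = ψ (decicForm b ε x) * ψ (decicForm b ε y) * ψ (y ^ 9 * decicRadical b ε x) := by
  have hψ9 (z : F) : ψ z = ψ (z ^ 9) := by
    rw [show z ^ 9 = (z ^ 3) ^ 3 by ring, hψ3, hψ3]
  have hε9 : ε ^ 9 = ε := by rw [show ε ^ 9 = (ε ^ 3) ^ 3 by ring, hε, hε]
  rw [decicForm_add, AddChar.map_add_eq_mul, AddChar.map_add_eq_mul]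
  congr 1
  calc _ = ψ (ε * b ^ 3 * x ^ 9 * y) * ψ (ε * b ^ 3 * x * y ^ 9) * ψ (-(b * (x ^ 3 * y ^ 3)))
        * ψ (-(b ^ 3 * (x * y))) := by
        simp_rw [← AddChar.map_add_eq_mul]; ring_nf
    _ = ψ (ε * b ^ 27 * x ^ 81 * y ^ 9) * ψ (ε * b ^ 3 * x * y ^ 9)
        * ψ (-(b ^ 3 * (x ^ 9 * y ^ 9))) * ψ (-(b ^ 27 * (x ^ 9 * y ^ 9))) := by
        rw [hψ9 (ε * b ^ 3 * x ^ 9 * y), hψ9 (-(b ^ 3 * (x * y))),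
          ← hψ3 (-(b * (x ^ 3 * y ^ 3))),
          show (ε * b ^ 3 * x ^ 9 * y) ^ 9 = ε ^ 9 * b ^ 27 * x ^ 81 * y ^ 9 by ring, hε9]
        ring_nf
    _ = _ := by
        simp_rw [← AddChar.map_add_eq_mul, decicRadical]; ring_nf

theorem addChar_pow_three (ψ : AddChar F ℂ) (x : F) : ψ x ^ 3 = 1 := by
  have h3 : (3 : F) = 0 := CharP.cast_eq_zero F 3
  rw [← AddChar.map_nsmul_eq_pow, nsmul_eq_mul, Nat.cast_ofNat, h3, zero_mul,
    AddChar.map_zero_eq_one]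

variable [Fintype F]

theorem gaussSum_decicForm_mul_neg {ψ : AddChar F ℂ} (hψ : ψ.IsPrimitive)
    (hψ3 : ∀ x, ψ (x ^ 3) = ψ x) {b ε : F} (hε : ε ^ 3 = ε) :
    (∑ x, ψ (decicForm b ε x)) * ∑ x, ψ (-decicForm b ε x)
      = Fintype.card F * Nat.card {x // decicRadical b ε x = 0} :=
  gaussSum_mul_gaussSum_neg hψ (fun x => by simp only [decicForm]; ring)
    (addChar_decicForm_add hψ3 hε)

theorem gaussSum_decicForm_add_neg {ψ : AddChar F ℂ} {b ε : F} {k : ℕ} (hk : Odd k)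
    (hnorm : (∑ x, ψ (decicForm b ε x)) * ∑ x, ψ (-decicForm b ε x) = 3 ^ k) :
    ∑ x, ψ (decicForm b ε x) + ∑ x, ψ (-decicForm b ε x) = 0 := by
  simp_rw [AddChar.map_neg_eq_inv] at hnorm ⊢
  have h2 : (2 : F) ≠ 0 := fun h => one_ne_zero (α := F) <|
    eq_zero_of_eq_neg_self_of_charP_three (by linear_combination h)
  exact sum_add_sum_inv_eq_zero h2 (fun _ => addChar_pow_three ψ _) (by simp [decicForm])
    (fun x => by simp only [decicForm]; ring_nf) hk hnorm

variable {d : ℕ}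

theorem card_decicRadical_neg_one (hd : Odd d) (hF : Fintype.card F = 3 ^ d) {b : F} (hb : b ≠ 0) :
    Nat.card {x : F // decicRadical b (-1) x = 0} = 1 := by
  have hpow (x : F) : x ^ 9 ^ d = x := by
    rw [show 9 ^ d = Fintype.card F ^ 2 by rw [hF, ← pow_mul, mul_comm, pow_mul]; norm_num,
      FiniteField.pow_card_pow]
  have h (x : F) : decicRadical b (-1) x = 0 ↔ x = 0 := by
    refine ⟨fun hx => ?_, fun hx => by simp [hx, decicRadical]⟩
    have hy : (b ^ 3 * (x ^ 9 + x)) ^ 9 = -(b ^ 3 * (x ^ 9 + x)) := by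
      rw [mul_pow, add_pow_nine_of_charP]
      rw [decicRadical] at hx
      linear_combination -hx
    have := eq_zero_of_pow_nine_eq_neg hd (hpow _) hy
    refine eq_zero_of_pow_nine_eq_neg hd (hpow x) ?_
    simpa [hb, add_eq_zero_iff_eq_neg] using this
  simp [h]

theorem exists_pow_nine_sub_eq (hd : Odd d) (hF : Fintype.card F = 3 ^ d) {a : F}
    (ha : ∑ i ∈ range d, a ^ 3 ^ i = 0) : ∃ β, β ^ 9 - β = a ^ 3 := by
  obtain ⟨ψ, hψ, hψ3, hψa⟩ := exists_addChar_of_card_eq_three_pow hF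
  obtain ⟨t, rfl⟩ := exists_pow_three_sub_eq_of_addChar_eq_one hψ hψ3 (hψa a ha)
  have hinj : Function.Injective fun x : F => x ^ 3 + x := by
    intro x y hxy
    have h3 : (3 : F) = 0 := CharP.cast_eq_zero F 3
    have hz : (x - y) ^ 3 = -(x - y) := by
      rw [sub_eq_add_neg, add_pow_three_of_charP]
      linear_combination hxy
    have := eq_zero_of_eq_neg_self_of_charP_three
      ((hF ▸ FiniteField.pow_card (x - y)).symm.trans (pow_three_pow_of_pow_three_eq_neg hz hd))
    exact sub_eq_zero.mp this
  obtain ⟨β, hβ⟩ := (Finite.injective_iff_surjective.mp hinj) (t ^ 3)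
  refine ⟨β, ?_⟩
  have hβ' : β ^ 3 + β = t ^ 3 := hβ
  have h9 : β ^ 9 + β ^ 3 = t ^ 9 := by
    rw [show t ^ 9 = (t ^ 3) ^ 3 by ring, ← hβ', add_pow_three_of_charP]; ring
  rw [sub_eq_add_neg (t ^ 3), add_pow_three_of_charP]
  linear_combination h9 - hβ'

theorem card_decicRadical_one (hd : Odd d) (hF : Fintype.card F = 3 ^ d) {a b : F}
    (hab : a * b = 1) (ha : ∑ i ∈ range d, a ^ 3 ^ i = 0) :
    Nat.card {x : F // decicRadical b 1 x = 0} = 9 := by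
  have : Fact (Nat.Prime 3) := ⟨Nat.prime_three⟩
  have ha0 : a ≠ 0 := left_ne_zero_of_mul_eq_one hab
  obtain ⟨β, hβ⟩ := exists_pow_nine_sub_eq hd hF ha
  have hpow (x : F) : x ^ 3 ^ d = x := hF ▸ FiniteField.pow_card x
  let f : ZMod 3 →+* F := ZMod.castHom dvd_rfl F
  have hf3 (s : ZMod 3) : f s ^ 3 = f s := by rw [← map_pow, ZMod.pow_card]
  have hf9 (s : ZMod 3) : f s ^ 9 = f s := by
    rw [show f s ^ 9 = (f s ^ 3) ^ 3 by ring, hf3, hf3]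
  have hfs {x : F} (hx : x ^ 9 = x) : ∃ s, f s = x := by
    rcases eq_zero_or_one_or_neg_one_of_pow_three_eq_self
      (pow_three_eq_self_of_pow_nine_eq_self hd (hpow x) hx) with rfl | rfl | rfl
    exacts [⟨0, map_zero f⟩, ⟨1, map_one f⟩, ⟨-1, by simp⟩]
  have hdiff (p : ZMod 3 × ZMod 3) :
      (f p.1 * β + f p.2) ^ 9 - (f p.1 * β + f p.2) = f p.1 * a ^ 3 := by
    rw [add_pow_nine_of_charP, mul_pow, hf9, hf9]
    linear_combination f p.1 * hβ
  have hrad (x : F) : decicRadical b 1 x = (b ^ 3 * (x ^ 9 - x)) ^ 9 - b ^ 3 * (x ^ 9 - x) := by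
    rw [mul_pow, sub_eq_add_neg (x ^ 9), add_pow_nine_of_charP, decicRadical]
    ring
  have hba (z : F) : b ^ 3 * (z * a ^ 3) = z := by
    linear_combination z * (a ^ 2 * b ^ 2 + a * b + 1) * hab
  have hmem (p : ZMod 3 × ZMod 3) : decicRadical b 1 (f p.1 * β + f p.2) = 0 := by
    rw [hrad, hdiff, hba, hf9, sub_self]
  rw [← Nat.card_congr (Equiv.ofBijective
    (fun p : ZMod 3 × ZMod 3 => (⟨_, hmem p⟩ : {x : F // decicRadical b 1 x = 0})) ⟨?_, ?_⟩)]
  · simp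
  · intro p p' h
    have h' : f p.1 * β + f p.2 = f p'.1 * β + f p'.2 := congrArg Subtype.val h
    have h1 : p.1 = p'.1 := by
      refine f.injective (mul_right_cancel₀ (pow_ne_zero 3 ha0) ?_)
      rw [← hdiff, ← hdiff, h']
    rw [h1] at h'
    exact Prod.ext h1 (f.injective (add_left_cancel h'))
  · rintro ⟨x, hx⟩
    rw [hrad, sub_eq_zero] at hx
    obtain ⟨s, hs⟩ := hfs hx
    obtain ⟨e, he⟩ := hfs (x := x - f s * β) (by
      rw [sub_eq_add_neg, ← neg_mul, ← map_neg, add_pow_nine_of_charP, mul_pow, hf9, map_neg]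
      linear_combination -a ^ 3 * hs - f s * hβ - (x ^ 9 - x) * (a ^ 2 * b ^ 2 + a * b + 1) * hab)
    refine ⟨(s, e), Subtype.ext ?_⟩
    change f s * β + f e = x
    rw [he]; ring

end CharThree

section QuadraticExtension

variable {d : ℕ}

theorem three_pow_mod_four (hd : Odd d) : 3 ^ d % 4 = 3 := by
  obtain ⟨m, rfl⟩ := hd
  rw [pow_succ, pow_mul, Nat.mul_mod, Nat.pow_mod]
  norm_num

theorem not_isSquare_neg_one_of_card {F : Type*} [Field F] [Fintype F] (hd : Odd d)
    (hF : Fintype.card F = 3 ^ d) : ¬ IsSquare (-1 : F) := by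
  rw [FiniteField.isSquare_neg_one_iff, hF, not_not, three_pow_mod_four hd]

theorem exists_sq_eq_neg_one_of_card {F : Type*} [Field F] [Fintype F] (hd : Odd d)
    (hF : Fintype.card F = (3 ^ d) ^ 2) : ∃ I : F, I ^ 2 = -1 := by
  have : IsSquare (-1 : F) := by
    rw [FiniteField.isSquare_neg_one_iff, hF, Nat.pow_mod, three_pow_mod_four hd]
    norm_num
  obtain ⟨I, hI⟩ := this
  exact ⟨I, by rw [sq, hI]⟩

theorem not_isSquare_one_add_of_sq_eq_neg_one {F : Type*} [Field F] [Fintype F] [CharP F 3]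
    (hd : Odd d) (hF : Fintype.card F = (3 ^ d) ^ 2) {I : F} (hI : I ^ 2 = -1) :
    ¬ IsSquare (1 + I) := by
  rintro ⟨s, hs⟩
  have h3 : (3 : F) = 0 := CharP.cast_eq_zero F 3
  have h8 : (1 + I) ^ 4 = -1 := by
    linear_combination (I ^ 2 + 4 * I + 5) * hI - h3
  have h9 : s ^ 9 = -s := by
    calc s ^ 9 = s * (s * s) ^ 4 := by ring
      _ = -s := by rw [← hs, h8, mul_neg_one]
  have hs0 : s = 0 := by
    refine eq_zero_of_pow_nine_eq_neg hd ?_ h9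
    rw [show 9 ^ d = Fintype.card F by rw [hF, ← pow_mul, mul_comm, pow_mul]; norm_num,
      FiniteField.pow_card]
  rw [hs, hs0] at h8
  norm_num at h8

variable {K L : Type*} [Field K] [Field L] [Algebra K L]

/-- Coordinates of `L` over `K` with respect to `1` and a square root `I` of `-1`. -/
theorem bijective_add_mul_of_sq_eq_neg_one [Fintype K] [Fintype L] (hd : Odd d)
    (hK : Fintype.card K = 3 ^ d)
    (hL : Fintype.card L = (3 ^ d) ^ 2) {I : L} (hI : I ^ 2 = -1) :
    Function.Bijective fun p : K × K => algebraMap K L p.1 + I * algebraMap K L p.2 := by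
  rw [Fintype.bijective_iff_injective_and_card, Fintype.card_prod, hK, hL, sq]
  refine ⟨fun ⟨u, v⟩ ⟨u', v'⟩ h => ?_, rfl⟩
  have h' : algebraMap K L (u - u') = I * algebraMap K L (v' - v) := by
    simp only [map_sub]
    linear_combination h
  have hsq : (u - u') ^ 2 = -(v' - v) ^ 2 := by
    refine (algebraMap K L).injective ?_
    rw [map_pow, h', map_neg, map_pow]
    linear_combination algebraMap K L (v' - v) ^ 2 * hI
  have hv : v' - v = 0 := by
    by_contra hne
    refine not_isSquare_neg_one_of_card hd hK ⟨(u - u') / (v' - v), ?_⟩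
    field_simp
    linear_combination -hsq
  have hu : u - u' = 0 := by simpa [hv] using hsq
  rw [sub_eq_zero.mp hu, sub_eq_zero.mp hv]

theorem addChar_mul_algebraMap_eq_one [Fintype K] [CharP L 3] {ψ : AddChar L ℂ}
    (hψ3 : ∀ x, ψ (x ^ 3) = ψ x) (hd : Odd d) (hK : Fintype.card K = 3 ^ d) {I : L} (hI : I ^ 2 = -1) (u : K) :
    ψ (I * algebraMap K L u) = 1 := by
  have hiter (m : ℕ) (x : L) : ψ (x ^ 3 ^ m) = ψ x := by
    induction m with
    | zero => simp
    | succ m ih => rw [pow_succ, pow_mul, hψ3, ih]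
  have hI3 : I ^ 3 = -I := by linear_combination I * hI
  have h := hiter d (I * algebraMap K L u)
  rw [mul_pow, pow_three_pow_of_pow_three_eq_neg hI3 hd, ← map_pow, ← hK, FiniteField.pow_card,
    neg_mul, AddChar.map_neg_eq_inv] at h
  have h0 : ψ (I * algebraMap K L u) ≠ 0 := (ψ.val_isUnit _).ne_zero
  have h2 : ψ (I * algebraMap K L u) ^ 2 = 1 := by
    rw [sq]
    nth_rewrite 1 [← h]
    exact inv_mul_cancel₀ h0
  have h3 := addChar_pow_three ψ (I * algebraMap K L u)
  rwa [pow_succ, h2, one_mul] at h3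

theorem decicForm_neg_one_add_mul [CharP K 3] (b u v : K) {I : L} (hI : I ^ 2 = -1) :
    ∃ w, decicForm (algebraMap K L b) (-1) (algebraMap K L u + I * algebraMap K L v)
      = algebraMap K L (decicForm b (-1) u - decicForm b (-1) v) + I * algebraMap K L w := by
  have : CharP L 3 := charP_of_injective_algebraMap (algebraMap K L).injective 3
  refine ⟨-(b ^ 3 * (u ^ 9 * v + u * v ^ 9)) - b * (2 * u ^ 3 * v ^ 3) + b ^ 3 * (2 * u * v), ?_⟩
  simp only [decicForm, map_sub, map_add, map_mul, map_pow, map_neg, map_one, map_ofNat]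
  generalize algebraMap K L b = b, algebraMap K L u = u, algebraMap K L v = v
  have e3 : (u + I * v) ^ 3 = u ^ 3 - I * v ^ 3 := by
    rw [add_pow_three_of_charP]
    linear_combination I * v ^ 3 * hI
  have e9 : (u + I * v) ^ 9 = u ^ 9 + I * v ^ 9 := by
    rw [add_pow_nine_of_charP]
    linear_combination (I ^ 7 - I ^ 5 + I ^ 3 - I) * v ^ 9 * hI
  have e10 : (u + I * v) ^ 10 = (u ^ 9 + I * v ^ 9) * (u + I * v) := by rw [← e9]; ring
  have e6 : (u + I * v) ^ 6 = (u ^ 3 - I * v ^ 3) ^ 2 := by rw [← e3]; ring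
  rw [e10, e6]
  linear_combination (-b ^ 3 * v ^ 10 + b * v ^ 6 + b ^ 3 * v ^ 2) * hI

theorem decicForm_one_add_mul [CharP K 3] (b u v : K) {I : L} (hI : I ^ 2 = -1) :
    ∃ w, -(algebraMap K L b ^ 3 * ((1 + I) * (algebraMap K L u + I * algebraMap K L v) ^ 2) ^ 5)
        + algebraMap K L b * ((1 + I) * (algebraMap K L u + I * algebraMap K L v) ^ 2) ^ 3
        + algebraMap K L b ^ 3 * ((1 + I) * (algebraMap K L u + I * algebraMap K L v) ^ 2)
      = algebraMap K L (-decicForm b 1 u - decicForm b 1 (u + v)) + I * algebraMap K L w := by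
  have : CharP L 3 := charP_of_injective_algebraMap (algebraMap K L).injective 3
  have h3 : (3 : L) = 0 := CharP.cast_eq_zero L 3
  refine ⟨b ^ 3 * (u ^ 10 - v ^ 10 + u ^ 9 * v + u * v ^ 9)
    + b * (-2 * u ^ 3 * v ^ 3 - u ^ 6 + v ^ 6) + b ^ 3 * (u ^ 2 - v ^ 2 + 2 * u * v), ?_⟩
  rw [decicForm_add]
  simp only [decicForm, map_sub, map_add, map_mul, map_pow, map_neg, map_one, map_ofNat]
  generalize algebraMap K L b = b, algebraMap K L u = u, algebraMap K L v = v
  have e3 : (u + I * v) ^ 3 = u ^ 3 - I * v ^ 3 := by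
    rw [add_pow_three_of_charP]
    linear_combination I * v ^ 3 * hI
  have e9 : (u + I * v) ^ 9 = u ^ 9 + I * v ^ 9 := by
    rw [add_pow_nine_of_charP]
    linear_combination (I ^ 7 - I ^ 5 + I ^ 3 - I) * v ^ 9 * hI
  have e10 : (u + I * v) ^ 10
      = (u ^ 10 - v ^ 10) + I * (u ^ 9 * v + u * v ^ 9) := by
    rw [show (u + I * v) ^ 10 = (u + I * v) ^ 9 * (u + I * v) by ring, e9]
    linear_combination v ^ 10 * hI
  have e6 : (u + I * v) ^ 6 = (u ^ 6 - v ^ 6) - I * (2 * u ^ 3 * v ^ 3) := by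
    rw [show (u + I * v) ^ 6 = ((u + I * v) ^ 3) ^ 2 by ring, e3]
    linear_combination v ^ 6 * hI
  have e2 : (u + I * v) ^ 2 = (u ^ 2 - v ^ 2) + I * (2 * u * v) := by
    linear_combination v ^ 2 * hI
  have n3 : (1 + I) ^ 3 = 1 - I := by
    linear_combination (I + 3) * hI + (I - 1) * h3
  have n5 : (1 + I) ^ 5 = -(1 + I) := by
    linear_combination (1 + I) * (I ^ 2 + 4 * I + 5) * hI - (1 + I) * h3
  have hsplit : -(b ^ 3 * ((1 + I) * (u + I * v) ^ 2) ^ 5) + b * ((1 + I) * (u + I * v) ^ 2) ^ 3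
      + b ^ 3 * ((1 + I) * (u + I * v) ^ 2)
      = -(b ^ 3 * ((1 + I) ^ 5 * (u + I * v) ^ 10)) + b * ((1 + I) ^ 3 * (u + I * v) ^ 6)
        + b ^ 3 * ((1 + I) * (u + I * v) ^ 2) := by ring
  rw [hsplit, n3, n5, e10, e6, e2]
  linear_combination (b ^ 3 * (u ^ 9 * v + u * v ^ 9) + b * (2 * u ^ 3 * v ^ 3)
    + b ^ 3 * (2 * u * v)) * hI
    + (b ^ 3 * u ^ 10 + b * u ^ 6 + b ^ 3 * u ^ 2 - b * u ^ 3 * v ^ 3 - b ^ 3 * u * v) * h3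

end QuadraticExtension

section Counts

variable {K : Type*} [Field K] [Fintype K] [CharP K 3] {d : ℕ}

theorem gaussSum_decicForm_neg_one {ψ : AddChar K ℂ} (hψ : ψ.IsPrimitive)
    (hψ3 : ∀ x, ψ (x ^ 3) = ψ x) (hd : Odd d) (hK : Fintype.card K = 3 ^ d) {b : K} (hb : b ≠ 0) :
    (∑ x, ψ (decicForm b (-1) x)) * ∑ x, ψ (-decicForm b (-1) x) = 3 ^ d := by
  rw [gaussSum_decicForm_mul_neg hψ hψ3 (by norm_num), card_decicRadical_neg_one hd hK hb, hK]
  push_cast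
  ring

theorem gaussSum_decicForm_one {ψ : AddChar K ℂ} (hψ : ψ.IsPrimitive)
    (hψ3 : ∀ x, ψ (x ^ 3) = ψ x) (hd : Odd d) (hK : Fintype.card K = 3 ^ d) {a b : K}
    (hab : a * b = 1) (ha : ∑ i ∈ range d, a ^ 3 ^ i = 0) :
    (∑ x, ψ (decicForm b 1 x)) * ∑ x, ψ (-decicForm b 1 x) = 3 ^ (d + 2) := by
  rw [gaussSum_decicForm_mul_neg hψ hψ3 (by norm_num), card_decicRadical_one hd hK hab ha, hK]
  push_cast
  ring

theorem charSum_base_eq_zero {ψ : AddChar K ℂ} (hψ : ψ.IsPrimitive)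
    (hψ3 : ∀ x, ψ (x ^ 3) = ψ x) (hd : Odd d) (hK : Fintype.card K = 3 ^ d) {b : K} (hb : b ≠ 0) :
    ∑ w, ψ (-(b ^ 3 * w ^ 5) + b * w ^ 3 + b ^ 3 * w) = 0 := by
  have h2 : ringChar K ≠ 2 := by rw [ringChar.eq K 3]; norm_num
  have h := sum_sq_add_sum_nonsquare_mul_sq h2 (not_isSquare_neg_one_of_card hd hK)
    fun w => ψ (-(b ^ 3 * w ^ 5) + b * w ^ 3 + b ^ 3 * w)
  have h0 := gaussSum_decicForm_add_neg hd (gaussSum_decicForm_neg_one hψ hψ3 hd hK hb)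
  have e1 (x : K) : -(b ^ 3 * (x ^ 2) ^ 5) + b * (x ^ 2) ^ 3 + b ^ 3 * x ^ 2
      = decicForm b (-1) x := by rw [decicForm]; ring
  have e2 (x : K) : -(b ^ 3 * (-1 * x ^ 2) ^ 5) + b * (-1 * x ^ 2) ^ 3 + b ^ 3 * (-1 * x ^ 2)
      = -decicForm b (-1) x := by rw [decicForm]; ring
  simp_rw [e1, e2, h0] at h
  simpa using h.symm

theorem charSum_quadraticExtension {L : Type*} [Field L] [Fintype L] [Algebra K L] [CharP L 3]
    {ψ : AddChar L ℂ} (hψ : ψ.IsPrimitive)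
    (hψ3 : ∀ x, ψ (x ^ 3) = ψ x) (hd : Odd d) (hK : Fintype.card K = 3 ^ d)
    (hL : Fintype.card L = (3 ^ d) ^ 2) {a b : K}
    (hab : a * b = 1) (ha : ∑ i ∈ range d, a ^ 3 ^ i = 0) :
    ∑ w, ψ (-(algebraMap K L b ^ 3 * w ^ 5) + algebraMap K L b * w ^ 3 + algebraMap K L b ^ 3 * w)
      = -4 * 3 ^ d := by
  obtain ⟨I, hI⟩ := exists_sq_eq_neg_one_of_card hd hL
  let χ : AddChar K ℂ := ψ.compAddMonoidHom (algebraMap K L : K →+ L)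
  have hχψ (u v : K) : ψ (algebraMap K L u + I * algebraMap K L v) = χ u := by
    rw [AddChar.map_add_eq_mul, addChar_mul_algebraMap_eq_one hψ3 hd hK hI, mul_one]
    rfl
  have hbij := bijective_add_mul_of_sq_eq_neg_one hd hK hL hI
  have hχ3 (x : K) : χ (x ^ 3) = χ x := by
    change ψ (algebraMap K L (x ^ 3)) = ψ (algebraMap K L x)
    rw [map_pow, hψ3]
  have hχ : χ.IsPrimitive := by
    refine AddChar.IsPrimitive.of_ne_one fun h => ?_
    have hψ1 : ψ = 1 := by
      ext x
      obtain ⟨⟨u, v⟩, rfl⟩ := hbij.surjective x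
      change ψ (algebraMap K L u + I * algebraMap K L v) = 1
      rw [hχψ, h, AddChar.one_apply]
    have := hψ one_ne_zero
    rw [AddChar.mulShift_one] at this
    exact this hψ1
  have h2 : ringChar L ≠ 2 := by rw [ringChar.eq L 3]; norm_num
  have h := sum_sq_add_sum_nonsquare_mul_sq h2 (not_isSquare_one_add_of_sq_eq_neg_one hd hL hI)
    fun w => ψ (-(algebraMap K L b ^ 3 * w ^ 5) + algebraMap K L b * w ^ 3
      + algebraMap K L b ^ 3 * w)
  rw [← hbij.sum_comp, ← hbij.sum_comp, Fintype.sum_prod_type, Fintype.sum_prod_type] at h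
  have e1 (u v : K) : ψ (-(algebraMap K L b ^ 3 * ((algebraMap K L u + I * algebraMap K L v) ^ 2) ^ 5)
        + algebraMap K L b * ((algebraMap K L u + I * algebraMap K L v) ^ 2) ^ 3
        + algebraMap K L b ^ 3 * (algebraMap K L u + I * algebraMap K L v) ^ 2)
      = χ (decicForm b (-1) u) * χ (-decicForm b (-1) v) := by
    obtain ⟨w, hw⟩ := decicForm_neg_one_add_mul b u v hI
    rw [← AddChar.map_add_eq_mul, ← sub_eq_add_neg, ← hχψ _ w, ← hw, decicForm]
    ring_nf
  have e2 (u v : K) : ψ (-(algebraMap K L b ^ 3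
          * ((1 + I) * (algebraMap K L u + I * algebraMap K L v) ^ 2) ^ 5)
        + algebraMap K L b * ((1 + I) * (algebraMap K L u + I * algebraMap K L v) ^ 2) ^ 3
        + algebraMap K L b ^ 3 * ((1 + I) * (algebraMap K L u + I * algebraMap K L v) ^ 2))
      = χ (-decicForm b 1 u) * χ (-decicForm b 1 (u + v)) := by
    obtain ⟨w, hw⟩ := decicForm_one_add_mul b u v hI
    rw [hw, hχψ, sub_eq_add_neg, AddChar.map_add_eq_mul]
  simp_rw [e1, e2] at h
  have hshift (u : K) : ∑ v, χ (-decicForm b 1 u) * χ (-decicForm b 1 (u + v))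
      = ∑ v, χ (-decicForm b 1 u) * χ (-decicForm b 1 v) :=
    Equiv.sum_comp (Equiv.addLeft u) fun v => χ (-decicForm b 1 u) * χ (-decicForm b 1 v)
  simp_rw [hshift] at h
  rw [← Finset.sum_mul_sum, ← Finset.sum_mul_sum,
    gaussSum_decicForm_neg_one hχ hχ3 hd hK (right_ne_zero_of_mul_eq_one hab)] at h
  have hnorm := gaussSum_decicForm_one hχ hχ3 hd hK hab ha
  have hzero := gaussSum_decicForm_add_neg (hd.add_even even_two) hnorm
  rw [eq_neg_of_add_eq_zero_left hzero, pow_add] at hnorm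
  linear_combination (-1 / 2 : ℂ) * h - (1 / 2 : ℂ) * hnorm

end Counts

/-- For `q = 3^d` with `d` odd and `a ∈ F_q` nonzero with `Tr_{F_q/F_3}(a) = 0`, the
genus-2 curve `y² = z⁶ + a²z³ + a²z + a⁴ + 1` has `q - 1` affine points over `F_q` and
`q² - 4q - 1` affine points over `F_{q²}` (so its Weil polynomial is
`x⁴ - 2qx² + q²`). -/
theorem stmt_19 (d : ℕ) (hd : Odd d) (q : ℕ) (hq : q = 3 ^ d)
    (K : Type*) [Field K] [Fintype K] (hK : Fintype.card K = q)
    (a : K) (ha0 : a ≠ 0) (ha : ∑ i ∈ Finset.range d, a ^ 3 ^ i = 0)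
    (L : Type*) [Field L] [Fintype L] [Algebra K L] (hL : Fintype.card L = q ^ 2) :
    (Nat.card {P : K × K //
        P.2 ^ 2 = P.1 ^ 6 + a ^ 2 * P.1 ^ 3 + a ^ 2 * P.1 + a ^ 4 + 1} : ℤ)
      = (q : ℤ) - 1 ∧
    (Nat.card {P : L × L //
        P.2 ^ 2 = P.1 ^ 6 + (algebraMap K L a) ^ 2 * P.1 ^ 3
          + (algebraMap K L a) ^ 2 * P.1 + (algebraMap K L a) ^ 4 + 1} : ℤ)
      = (q : ℤ) ^ 2 - 4 * q - 1 := by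
  subst hq
  have : Fact (Nat.Prime 3) := ⟨Nat.prime_three⟩
  have : CharP K 3 := charP_of_card_eq_prime_pow hK
  have : CharP L 3 := charP_of_injective_algebraMap (algebraMap K L).injective 3
  have hab : a * a⁻¹ = 1 := mul_inv_cancel₀ ha0
  have habL : algebraMap K L a * algebraMap K L a⁻¹ = 1 := by rw [← map_mul, hab, map_one]
  obtain ⟨ψ, hψ, hψ3, -⟩ := exists_addChar_of_card_eq_three_pow hK
  obtain ⟨χ, hχ, hχ3, -⟩ := exists_addChar_of_card_eq_three_pow (hL.trans (pow_mul 3 d 2).symm)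
  have h1 := card_curve_eq_charSum hψ hψ3 hab
  rw [charSum_base_eq_zero hψ hψ3 hd hK (inv_ne_zero ha0), hK, add_zero] at h1
  have h2 := card_curve_eq_charSum hχ hχ3 habL
  rw [charSum_quadraticExtension hχ hχ3 hd hK hL hab ha, hL] at h2
  constructor
  · exact_mod_cast h1
  · rw [← Int.cast_inj (α := ℂ)]
    push_cast at h2 ⊢
    linear_combination h2
end
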